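/- Let F be a (2,1)-type 3-uniform hypergraph with respect to a vertex partition V(F) = A ∪ B. Then π_⋅(F) > 0 if and only if for every labeling of A there exists a vertex u ∈ B such that the link graph L_F(u) contains a monotone P3 (with respect to that labeling of A). -/

import Mathlib

open Filter

/-- A 3-uniform hypergraph on vertex type `V`: a set of edges, each of size 3. -/
structure H3 (V : Type) [DecidableEq V] where
  edges : Finset (Finset V)
  card3 : ∀ e ∈ edges, e.card = 3

namespace H3

variable {V W : Type} [DecidableEq V] [DecidableEq W]

/-- `H` contains a copy of `F`: an injection of vertices mapping edges to edges. -/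
def contains (H : H3 V) (F : H3 W) : Prop :=
  ∃ f : W → V, Function.Injective f ∧ ∀ e ∈ F.edges, e.image f ∈ H.edges

/-- `H` is `F`-free. -/
def free (H : H3 V) (F : H3 W) : Prop := ¬ H.contains F

/-- The codegree of a pair of vertices: the number of edges containing both. -/
def codeg (H : H3 V) (u v : V) : ℕ :=
  (H.edges.filter fun e => u ∈ e ∧ v ∈ e).card

/-- The minimum codegree: the minimum of `codeg` over pairs of distinct vertices. -/
noncomputable def minCodeg [Fintype V] (H : H3 V) : ℕ :=
  sInf {d | ∃ u v : V, u ≠ v ∧ H.codeg u v = d}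

/-- `H` is uniformly `(d, η)`-dense: every vertex subset `U` spans at least
`d * C(|U|,3) - η * n^3` edges. -/
def uniformlyDense [Fintype V] (H : H3 V) (d η : ℝ) : Prop :=
  ∀ U : Finset V,
    d * (U.card.choose 3 : ℝ) - η * (Fintype.card V : ℝ) ^ 3
      ≤ ((H.edges.filter fun e => e ⊆ U).card : ℝ)

end H3

/-- The uniform Turán density `π_⋅(F)`. -/
noncomputable def uniformTuranDensity {W : Type} [DecidableEq W] (F : H3 W) : ℝ :=
  sSup {d : ℝ | 0 ≤ d ∧ d ≤ 1 ∧
    ∀ η : ℝ, 0 < η → ∀ n₀ : ℕ, ∃ n, n₀ ≤ n ∧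
      ∃ H : H3 (Fin n), H.free F ∧ H.uniformlyDense d η}

/-- The codegree Turán number `ex_co(n, F)`: the maximum minimum codegree of an
`n`-vertex `F`-free 3-graph. -/
noncomputable def exCodeg {W : Type} [DecidableEq W] (n : ℕ) (F : H3 W) : ℕ :=
  sSup {d | ∃ H : H3 (Fin n), H.free F ∧ H.minCodeg = d}

/-- The codegree Turán density `π_co(F) = lim_n ex_co(n,F)/n` (the limit exists,
so it coincides with the limsup). -/
noncomputable def codegTuranDensity {W : Type} [DecidableEq W] (F : H3 W) : ℝ :=
  Filter.limsup (fun n : ℕ => (exCodeg n F : ℝ) / n) Filter.atTop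

open InnerProductSpace in
theorem exists_feature_map {X : Type} (k : X → X → ℝ) (hsymm : ∀ x y, k x y = k y x)
    (hpos : ∀ v : X →₀ ℝ, 0 ≤ v.sum fun x a => v.sum fun y b => k x y * (a * b)) :
    ∃ (H : Type) (_ : NormedAddCommGroup H) (_ : InnerProductSpace ℝ H) (_ : CompleteSpace H)
      (e : X → H), ∀ x y, inner ℝ (e x) (e y) = k x y := by
  let K : Matrix X X (ℝ →L[ℝ] ℝ) := .of fun x y => k x y • ContinuousLinearMap.id ℝ ℝ
  have hK : K.PosSemidef := by
    refine ((RKHS.posSemidef_tfae (𝕜 := ℝ) (K := K)).out 0 2).mpr ?_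
    refine ⟨?_, fun vv => ?_⟩
    · ext x y
      have : star (ContinuousLinearMap.id ℝ ℝ) = ContinuousLinearMap.id ℝ ℝ := star_one (ℝ →L[ℝ] ℝ)
      simp [K, Matrix.conjTranspose_apply, hsymm x y, this]
    · have := hpos vv
      convert this using 1
      simp only [RCLike.re_to_real]
      refine Finsupp.sum_congr fun x _ => Finsupp.sum_congr fun y _ => ?_
      simp [K, hsymm x y]
      ring
  have : Fact K.PosSemidef := ⟨hK⟩
  refine ⟨RKHS.OfKernel K, inferInstance, inferInstance, inferInstance,
    fun x => RKHS.kerFun (RKHS.OfKernel K) x (1 : ℝ), fun x y => ?_⟩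
  have := RKHS.kernel_inner (𝕜 := ℝ) (H := RKHS.OfKernel K) y x (1 : ℝ) (1 : ℝ)
  rw [← this, RKHS.OfKernel.kernel_ofKernel]
  simp [K, hsymm x y]

open Topology in
/-- Bounded families in a Hilbert space converge weakly along ultrafilters. -/
theorem Ultrafilter.exists_weak_limit {H : Type} [NormedAddCommGroup H] [InnerProductSpace ℝ H]
    [CompleteSpace H] {α : Type} (U : Ultrafilter α) (x : α → H) (C : ℝ)
    (hC : ∀ a, ‖x a‖ ≤ C) :
    ∃ w : H, ∀ y, Tendsto (fun a => inner ℝ (x a) y) U (𝓝 (inner ℝ w y)) := by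
  have key : ∀ y : H, ∃ l : ℝ, Tendsto (fun a => inner ℝ (x a) y) U (𝓝 l) := fun y => by
    have hc : IsCompact (Set.Icc (-(C * ‖y‖)) (C * ‖y‖)) := isCompact_Icc
    obtain ⟨l, -, hl⟩ := hc.ultrafilter_le_nhds (U.map fun a => inner ℝ (x a) y) (by
      simp only [Ultrafilter.coe_map, le_principal_iff]
      refine Filter.mem_map.2 (Filter.univ_mem' fun a => ?_)
      have := abs_real_inner_le_norm (x a) y
      exact abs_le.1 (this.trans (mul_le_mul_of_nonneg_right (hC a) (norm_nonneg _))))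
    exact ⟨l, hl⟩
  choose l hl using key
  let f : H →ₗ[ℝ] ℝ :=
    { toFun := l
      map_add' := fun y z => tendsto_nhds_unique (hl (y + z)) (by
        simpa [inner_add_right] using (hl y).add (hl z))
      map_smul' := fun r y => tendsto_nhds_unique (hl (r • y)) (by
        simpa [inner_smul_right] using (hl y).const_mul r) }
  let g : H →L[ℝ] ℝ := f.mkContinuous C fun y => by
    refine le_of_tendsto (hl y).norm (Eventually.of_forall fun a => ?_)
    exact (abs_real_inner_le_norm (x a) y).trans
      (mul_le_mul_of_nonneg_right (hC a) (norm_nonneg _))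
  refine ⟨(InnerProductSpace.toDual ℝ H).symm g, fun y => ?_⟩
  rw [InnerProductSpace.toDual_symm_apply]
  exact hl y

section UltraLim

open Topology

/-- The limit of a real-valued function along an ultrafilter. -/
noncomputable def ulim {α : Type} (U : Ultrafilter α) (f : α → ℝ) : ℝ :=
  limUnder (U : Filter α) f

variable {α β : Type} {U : Ultrafilter α} {f g : α → ℝ}

theorem tendsto_ulim (hf : ∀ a, f a ∈ Set.Icc (0 : ℝ) 1) :
    Tendsto f U (𝓝 (ulim U f)) := by
  obtain ⟨l, -, hl⟩ := (isCompact_Icc (a := (0 : ℝ)) (b := 1)).ultrafilter_le_nhds (U.map f) (by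
    simp only [Ultrafilter.coe_map, le_principal_iff]
    exact Filter.mem_map.2 (Filter.univ_mem' hf))
  exact tendsto_nhds_limUnder ⟨l, hl⟩

theorem ulim_eq_of_tendsto {l : ℝ} (h : Tendsto f U (𝓝 l)) : ulim U f = l := h.limUnder_eq

theorem ulim_mem (hf : ∀ a, f a ∈ Set.Icc (0 : ℝ) 1) : ulim U f ∈ Set.Icc (0 : ℝ) 1 :=
  isClosed_Icc.mem_of_tendsto (tendsto_ulim hf) (Eventually.of_forall hf)

theorem ulim_mono (hf : ∀ a, f a ∈ Set.Icc (0 : ℝ) 1) (hg : ∀ a, g a ∈ Set.Icc (0 : ℝ) 1)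
    (h : ∀ a, f a ≤ g a) : ulim U f ≤ ulim U g :=
  le_of_tendsto_of_tendsto' (tendsto_ulim hf) (tendsto_ulim hg) h

theorem le_ulim {c : ℝ} (hf : ∀ a, f a ∈ Set.Icc (0 : ℝ) 1)
    (h : ∀ᶠ a in (U : Filter α), c ≤ f a) : c ≤ ulim U f :=
  ge_of_tendsto (tendsto_ulim hf) h

theorem ulim_pure (a : α) (f : α → ℝ) : ulim (pure a) f = f a :=
  ulim_eq_of_tendsto (by simpa using tendsto_pure_nhds f a)

theorem ulim_map (h : β → α) (V : Ultrafilter β) (hf : ∀ a, f a ∈ Set.Icc (0 : ℝ) 1) :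
    ulim (V.map h) f = ulim V fun b => f (h b) := by
  refine ulim_eq_of_tendsto ?_
  rw [Ultrafilter.coe_map, tendsto_map'_iff]
  exact tendsto_ulim fun b => hf (h b)

theorem ulim_bind (V : Ultrafilter β) (m : β → Ultrafilter α)
    (hf : ∀ a, f a ∈ Set.Icc (0 : ℝ) 1) :
    ulim (V.bind m) f = ulim V fun b => ulim (m b) f := by
  refine ulim_eq_of_tendsto ?_
  have h := tendsto_ulim (U := V) (f := fun b => ulim (m b) f) fun b => ulim_mem hf
  rw [(closed_nhds_basis _).tendsto_right_iff] 
  rintro s ⟨hs, hsc⟩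
  have h1 : ∀ᶠ b in (V : Filter β), ulim (m b) f ∈ interior s :=
    h (isOpen_interior.mem_nhds (mem_interior_iff_mem_nhds.2 hs))
  change {b | {a | f a ∈ s} ∈ m b} ∈ V
  filter_upwards [h1] with b hb
  exact tendsto_ulim (U := m b) hf (mem_interior_iff_mem_nhds.1 hb)

end UltraLim

/-- A function `q` on a join-semilattice such that `(x, y) ↦ q (x ⊔ y)` is a positive
semidefinite kernel. -/
def SupPosDef {P : Type} [SemilatticeSup P] (q : P → ℝ) : Prop :=
  ∀ v : P →₀ ℝ, 0 ≤ v.sum fun x a => v.sum fun y b => q (x ⊔ y) * (a * b)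

namespace SupPosDef

open Topology

variable {P R : Type} [SemilatticeSup P] [SemilatticeSup R] {q : P → ℝ}

theorem comp (hq : SupPosDef q) (g : R → P) (hg : ∀ x y, g (x ⊔ y) = g x ⊔ g y) :
    SupPosDef fun x => q (g x) := by
  intro v
  have h := hq (v.mapDomain g)
  rw [Finsupp.sum_mapDomain_index (by simp) (by intros; simp [mul_add, add_mul])] at h
  convert h using 1
  refine Finsupp.sum_congr fun x _ => ?_
  rw [Finsupp.sum_mapDomain_index (by simp) (by intros; ring)]
  simp [hg]

theorem limit {α : Type} (U : Ultrafilter α) {q : α → P → ℝ} (hq : ∀ a, SupPosDef (q a))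
    (h01 : ∀ a x, q a x ∈ Set.Icc (0 : ℝ) 1) : SupPosDef fun x => ulim U fun a => q a x := by
  intro v
  refine ge_of_tendsto' (f := fun a => v.sum fun x s => v.sum fun y t => q a (x ⊔ y) * (s * t))
    (x := (U : Filter α)) ?_ fun a => hq a v
  exact tendsto_finsetSum _ fun x _ => tendsto_finsetSum _ fun y _ =>
    (tendsto_ulim fun a => h01 a _).mul_const _

theorem exists_weak_limit (hq : SupPosDef q) (h01 : ∀ x, q x ∈ Set.Icc (0 : ℝ) 1) :
    ∃ (H : Type) (_ : NormedAddCommGroup H) (_ : InnerProductSpace ℝ H) (_ : CompleteSpace H)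
      (e : P → H), (∀ x y, inner ℝ (e x) (e y) = q (x ⊔ y)) ∧
      ∀ (α : Type) (U : Ultrafilter α) (s : α → P), ∃ w : H, ∀ y,
        Tendsto (fun a => inner ℝ (e (s a)) y) U (𝓝 (inner ℝ w y)) := by
  obtain ⟨H, _, _, _, e, he⟩ := exists_feature_map (fun x y => q (x ⊔ y))
    (fun x y => by rw [sup_comm]) hq
  refine ⟨H, _, _, inferInstance, e, he, fun α U s =>
    U.exists_weak_limit (fun a => e (s a)) 1 fun a => ?_⟩
  have h1 : ‖e (s a)‖ ^ 2 ≤ 1 := by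
    rw [← real_inner_self_eq_norm_sq, he]
    exact (h01 _).2
  exact (sq_le_one_iff₀ (norm_nonneg _)).1 h1

theorem ulim_comm (hq : SupPosDef q) (h01 : ∀ x, q x ∈ Set.Icc (0 : ℝ) 1) {α β : Type}
    (U : Ultrafilter α) (W : Ultrafilter β) (s : α → P) (t : β → P) :
    (ulim U fun a => ulim W fun b => q (s a ⊔ t b)) =
      ulim W fun b => ulim U fun a => q (s a ⊔ t b) := by
  obtain ⟨H, _, _, _, e, he, hw⟩ := hq.exists_weak_limit h01
  obtain ⟨w, hw1⟩ := hw α U s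
  obtain ⟨z, hz1⟩ := hw β W t
  have h1 : ∀ a, (ulim W fun b => q (s a ⊔ t b)) = inner ℝ (e (s a)) z := fun a =>
    ulim_eq_of_tendsto (by
      have := hz1 (e (s a))
      simp_rw [he] at this
      rw [real_inner_comm]
      simpa only [sup_comm] using this)
  have h2 : ∀ b, (ulim U fun a => q (s a ⊔ t b)) = inner ℝ (e (t b)) w := fun b =>
    ulim_eq_of_tendsto (by
      have := hw1 (e (t b))
      simp_rw [he] at this
      rw [real_inner_comm]
      simpa only using this)
  simp_rw [h1, h2]
  rw [ulim_eq_of_tendsto (hw1 z), ulim_eq_of_tendsto (hz1 w), real_inner_comm]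

theorem sq_ulim_le [OrderBot P] (hq : SupPosDef q) (h01 : ∀ x, q x ∈ Set.Icc (0 : ℝ) 1)
    {α : Type} (U : Ultrafilter α) (s : α → P) :
    (ulim U fun a => q (s a)) ^ 2 ≤
      ulim U fun a => ulim U fun b => q (s a ⊔ s b) := by
  obtain ⟨H, _, _, _, e, he, hw⟩ := hq.exists_weak_limit h01
  obtain ⟨w, hw1⟩ := hw α U s
  have h1 : (ulim U fun a => q (s a)) = inner ℝ w (e ⊥) := by
    refine ulim_eq_of_tendsto ?_
    simpa [he] using hw1 (e ⊥)
  have h2 : ∀ a, (ulim U fun b => q (s a ⊔ s b)) = inner ℝ (e (s a)) w := fun a =>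
    ulim_eq_of_tendsto (by
      have := hw1 (e (s a))
      simp_rw [he] at this
      rw [real_inner_comm]
      simpa only [sup_comm] using this)
  simp_rw [h2]
  rw [h1, ulim_eq_of_tendsto (hw1 w)]
  have h3 := real_inner_mul_inner_self_le w (e ⊥)
  have h4 : inner ℝ (e ⊥) (e ⊥) ≤ (1 : ℝ) := by
    rw [he]
    exact (h01 _).2
  have h5 : (0 : ℝ) ≤ inner ℝ w w := real_inner_self_nonneg
  nlinarith

end SupPosDef

theorem ulim_const {α : Type} (U : Ultrafilter α) (c : ℝ) : ulim U (fun _ => c) = c :=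
  ulim_eq_of_tendsto tendsto_const_nhds

theorem ulim_pow {α : Type} {U : Ultrafilter α} {f : α → ℝ}
    (hf : ∀ a, f a ∈ Set.Icc (0 : ℝ) 1) (n : ℕ) :
    ulim U (fun a => f a ^ n) = ulim U f ^ n :=
  ulim_eq_of_tendsto ((tendsto_ulim hf).pow n)

theorem ulim_pair {α β : Type} (U : Ultrafilter α) (W : Ultrafilter β) {f : α × β → ℝ}
    (hf : ∀ p, f p ∈ Set.Icc (0 : ℝ) 1) :
    ulim (U.bind fun a => W.map (Prod.mk a)) f = ulim U fun a => ulim W fun b => f (a, b) := by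
  rw [ulim_bind _ _ hf]
  simp_rw [ulim_map _ _ hf]

theorem SupPosDef.ulim_pair_comm {P : Type} [SemilatticeSup P] {q : P → ℝ} (hq : SupPosDef q)
    (h01 : ∀ x, q x ∈ Set.Icc (0 : ℝ) 1) {α β γ : Type} (U : Ultrafilter α) (V : Ultrafilter β)
    (W : Ultrafilter γ) (s : α → β → P) (t : γ → P) :
    (ulim U fun a => ulim V fun b => ulim W fun j => q (s a b ⊔ t j)) =
      ulim W fun j => ulim U fun a => ulim V fun b => q (s a b ⊔ t j) := by
  have h := hq.ulim_comm h01 (U.bind fun a => V.map (Prod.mk a)) W (fun p => s p.1 p.2) t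
  rw [ulim_pair U V (f := fun p => ulim W fun j => q (s p.1 p.2 ⊔ t j))
    fun _ => ulim_mem fun _ => h01 _] at h
  rw [h]
  congr 1
  funext j
  exact ulim_pair U V (f := fun p => q (s p.1 p.2 ⊔ t j)) fun _ => h01 _

/-- The distribution of the set of `k` entries of an iterated limit along `U`. -/
noncomputable def iterSet (U : Ultrafilter ℕ) : ℕ → Ultrafilter (Finset ℕ)
  | 0 => pure ∅
  | k + 1 => U.bind fun i => (iterSet U k).map (insert i)

section IterSet

variable {U : Ultrafilter ℕ} {f : Finset ℕ → ℝ}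

theorem ulim_iterSet_zero : ulim (iterSet U 0) f = f ∅ := ulim_pure _ _

theorem ulim_iterSet_succ (hf : ∀ s, f s ∈ Set.Icc (0 : ℝ) 1) (k : ℕ) :
    ulim (iterSet U (k + 1)) f = ulim U fun i => ulim (iterSet U k) fun I => f (insert i I) := by
  rw [iterSet, ulim_bind _ _ hf]
  simp_rw [ulim_map _ _ hf]

theorem ulim_iterSet_add (hf : ∀ s, f s ∈ Set.Icc (0 : ℝ) 1) (a b : ℕ) :
    ulim (iterSet U (a + b)) f =
      ulim (iterSet U a) fun I => ulim (iterSet U b) fun J => f (I ∪ J) := by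
  induction a generalizing f with
  | zero => simp [ulim_iterSet_zero]
  | succ a ih =>
    rw [Nat.succ_add, Nat.succ_eq_add_one, ulim_iterSet_succ hf,
      ulim_iterSet_succ fun I => ulim_mem fun _ => hf _]
    congr 1
    funext i
    rw [ih fun _ => hf _]
    simp_rw [Finset.insert_union]

theorem ulim_iterSet_succ_le (hf : ∀ s, f s ∈ Set.Icc (0 : ℝ) 1) (hanti : Antitone f) (k : ℕ) :
    ulim (iterSet U (k + 1)) f ≤ ulim (iterSet U k) f := by
  rw [ulim_iterSet_succ hf, ← ulim_const U (ulim (iterSet U k) f)]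
  exact ulim_mono (fun _ => ulim_mem fun _ => hf _) (fun _ => ulim_mem hf) fun i =>
    ulim_mono (fun _ => hf _) hf fun I => hanti (Finset.subset_insert i I)

theorem SupPosDef.pow_le_ulim_iterSet (hq : SupPosDef f) (hf : ∀ s, f s ∈ Set.Icc (0 : ℝ) 1)
    (hanti : Antitone f) (k : ℕ) :
    (ulim U fun i => f {i}) ^ 2 ^ k ≤ ulim (iterSet U k) f := by
  have h1 : ∀ k, (ulim U fun i => f {i}) ^ 2 ^ k ≤ ulim (iterSet U (2 ^ k)) f := by
    intro k
    induction k with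
    | zero =>
      have h := ulim_iterSet_succ (U := U) hf 0
      simp only [ulim_iterSet_zero, zero_add] at h
      simp [h]
    | succ k ih =>
      rw [pow_succ 2 k, pow_mul, mul_two, ulim_iterSet_add hf]
      exact (pow_le_pow_left₀ (pow_nonneg (ulim_mem fun _ => hf _).1 _) ih 2).trans
        (hq.sq_ulim_le hf _ id)
  have h2 : Antitone fun k => ulim (iterSet U k) f :=
    antitone_nat_of_succ_le (ulim_iterSet_succ_le hf hanti)
  exact (h1 k).trans (h2 Nat.lt_two_pow_self.le)

end IterSet

/-- The effect of reading a position `i` of colour `b`: a `true` position is added to the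
list `L` of open positions, a `false` position is joined to all open positions. -/
def patternStep (b : Bool) (i : ℕ) (S : Finset ℕ × Finset (ℕ × ℕ)) :
    Finset ℕ × Finset (ℕ × ℕ) :=
  if b then (insert i S.1, S.2) else (S.1, S.2 ∪ S.1 ×ˢ {i})

/-- The set of pairs produced by reading the positions `x` with colours `c`. -/
def patternSet : {k : ℕ} → (Fin k → Bool) → (Fin k → ℕ) → Finset ℕ × Finset (ℕ × ℕ) →
    Finset (ℕ × ℕ)
  | 0, _, _, S => S.2
  | _ + 1, c, x, S => patternSet (Fin.tail c) (Fin.tail x) (patternStep (c 0) (x 0) S)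

/-- The iterated limit of `q` over the positions of a pattern. -/
noncomputable def patternLim (U : Ultrafilter ℕ) (q : Finset (ℕ × ℕ) → ℝ) :
    {k : ℕ} → (Fin k → Bool) → Finset ℕ × Finset (ℕ × ℕ) → ℝ
  | 0, _, S => q S.2
  | _ + 1, c, S => ulim U fun i => patternLim U q (Fin.tail c) (patternStep (c 0) i S)

theorem subset_patternSet {k : ℕ} (c : Fin k → Bool) (x : Fin k → ℕ)
    (S : Finset ℕ × Finset (ℕ × ℕ)) : S.2 ⊆ patternSet c x S := by
  induction k generalizing S with
  | zero => exact subset_rfl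
  | succ k ih =>
    refine subset_trans ?_ (ih _ _ _)
    unfold patternStep
    split_ifs
    · exact subset_rfl
    · exact Finset.subset_union_left

theorem mk_mem_patternSet_of_mem {k : ℕ} (c : Fin k → Bool) (x : Fin k → ℕ)
    (S : Finset ℕ × Finset (ℕ × ℕ)) {i : ℕ} (hi : i ∈ S.1) {b : Fin k} (hb : c b = false) :
    (i, x b) ∈ patternSet c x S := by
  induction k generalizing S with
  | zero => exact b.elim0
  | succ k ih =>
    rw [patternSet]
    obtain rfl | ⟨b, rfl⟩ := b.eq_zero_or_eq_succ
    · refine subset_patternSet _ _ _ ?_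
      simp [patternStep, hb, hi]
    · refine ih (Fin.tail c) (Fin.tail x) _ ?_ hb
      unfold patternStep
      split_ifs
      · exact Finset.mem_insert_of_mem hi
      · exact hi

theorem mk_mem_patternSet {k : ℕ} (c : Fin k → Bool) (x : Fin k → ℕ)
    (S : Finset ℕ × Finset (ℕ × ℕ)) {a b : Fin k} (hab : a < b) (ha : c a = true)
    (hb : c b = false) : (x a, x b) ∈ patternSet c x S := by
  induction k generalizing S with
  | zero => exact b.elim0
  | succ k ih =>
    rw [patternSet]
    obtain ⟨b, rfl⟩ := Fin.exists_succ_eq.2 (Fin.ne_zero_of_lt hab)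
    obtain rfl | ⟨a, rfl⟩ := a.eq_zero_or_eq_succ
    · refine mk_mem_patternSet_of_mem (Fin.tail c) (Fin.tail x) _ ?_ hb
      simp [patternStep, ha]
    · exact ih (Fin.tail c) (Fin.tail x) _ (Fin.succ_lt_succ_iff.1 hab) ha hb

section Pattern

variable {U : Ultrafilter ℕ} {q : Finset (ℕ × ℕ) → ℝ}

theorem patternLim_mem (h01 : ∀ s, q s ∈ Set.Icc (0 : ℝ) 1) {k : ℕ} (c : Fin k → Bool)
    (S : Finset ℕ × Finset (ℕ × ℕ)) : patternLim U q c S ∈ Set.Icc (0 : ℝ) 1 := by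
  induction k generalizing S with
  | zero => exact h01 _
  | succ k ih => exact ulim_mem fun _ => ih _ _

theorem exists_patternSet_pos (hU : (U : Filter ℕ) ≤ atTop) (h01 : ∀ s, q s ∈ Set.Icc (0 : ℝ) 1)
    {k : ℕ} {𝒜 : Set (Finset ℕ × Finset (ℕ × ℕ))} (h𝒜 : 𝒜.Finite)
    (h : ∀ S ∈ 𝒜, ∀ c : Fin k → Bool, 0 < patternLim U q c S) (N : ℕ) :
    ∃ x : Fin k → ℕ, StrictMono x ∧ (∀ a, N < x a) ∧
      ∀ S ∈ 𝒜, ∀ c : Fin k → Bool, 0 < q (patternSet c x S) := by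
  induction k generalizing 𝒜 N with
  | zero => exact ⟨Fin.elim0, fun a => a.elim0, fun a => a.elim0, h⟩
  | succ k ih =>
    have h1 : ∀ᶠ i in (U : Filter ℕ), ∀ S ∈ 𝒜, ∀ c : Fin (k + 1) → Bool,
        0 < patternLim U q (Fin.tail c) (patternStep (c 0) i S) := by
      refine (eventually_all_finite h𝒜).2 fun S hS => eventually_all.2 fun c => ?_
      exact (tendsto_ulim fun i => patternLim_mem h01 _ _).eventually_const_lt (h S hS c)
    obtain ⟨i, hi, hNi⟩ := (h1.and (hU (eventually_gt_atTop N))).exists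
    obtain ⟨x, hx, hxi, hxq⟩ := ih (𝒜 := Set.image2 (fun b S => patternStep b i S) Set.univ 𝒜)
      (Set.finite_univ.image2 _ h𝒜) (by
        rintro _ ⟨b, -, S, hS, rfl⟩ c
        simpa using hi S hS (Fin.cons b c)) i
    refine ⟨Fin.cons i x, ?_, ?_, ?_⟩
    · intro a b hab
      obtain ⟨b, rfl⟩ := Fin.exists_succ_eq.2 (Fin.ne_zero_of_lt hab)
      obtain rfl | ⟨a, rfl⟩ := a.eq_zero_or_eq_succ
      · simpa using hxi b
      · simpa using hx (Fin.succ_lt_succ_iff.1 hab)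
    · intro a
      obtain rfl | ⟨a, rfl⟩ := a.eq_zero_or_eq_succ
      · simpa using hNi
      · simpa using hNi.trans (hxi a)
    · intro S hS c
      rw [patternSet]
      simpa using hxq _ ⟨c 0, trivial, S, hS, rfl⟩ (Fin.tail c)

theorem SupPosDef.le_patternLim (hq : SupPosDef q) (hanti : Antitone q)
    (h01 : ∀ s, q s ∈ Set.Icc (0 : ℝ) 1) {k : ℕ} (c : Fin k → Bool)
    (S : Finset ℕ × Finset (ℕ × ℕ)) :
    (ulim (iterSet U k) fun I => ulim (iterSet U k) fun J =>
      q (S.2 ∪ (S.1 ∪ I) ×ˢ J)) ≤ patternLim U q c S := by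
  induction k generalizing S with
  | zero => simp [ulim_iterSet_zero, patternLim]
  | succ k ih =>
    rw [patternLim]
    obtain ⟨L, s⟩ := S
    have hm1 : ∀ (A : Finset ℕ) (t : Finset (ℕ × ℕ)) (m : ℕ),
        (ulim (iterSet U m) fun J => q (t ∪ A ×ˢ J)) ∈ Set.Icc (0 : ℝ) 1 :=
      fun A t m => ulim_mem fun _ => h01 _
    cases hc : c 0 with
    | true =>
      rw [ulim_iterSet_succ fun _ => hm1 _ _ _]
      refine ulim_mono (fun i => ulim_mem fun _ => hm1 _ _ _) (fun i => patternLim_mem h01 _ _)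
        fun i => le_trans ?_ (ih _ _)
      simp only [patternStep, if_true]
      refine ulim_mono (fun _ => hm1 _ _ _) (fun _ => hm1 _ _ _) fun I => ?_
      rw [Finset.union_insert, Finset.insert_union]
      refine ulim_iterSet_succ_le (fun _ => h01 _) (fun J J' hJ => hanti ?_) k
      exact Finset.union_subset_union subset_rfl (Finset.product_subset_product subset_rfl hJ)
    | false =>
      have e1 : (ulim (iterSet U (k + 1)) fun I => ulim (iterSet U (k + 1)) fun J =>
          q (s ∪ (L ∪ I) ×ˢ J)) ≤ ulim (iterSet U k) fun I =>
            ulim (iterSet U (k + 1)) fun J => q (s ∪ (L ∪ I) ×ˢ J) := by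
        refine ulim_iterSet_succ_le (fun _ => hm1 _ _ _) (fun I I' hI => ?_) k
        refine ulim_mono (fun _ => h01 _) (fun _ => h01 _) fun J => hanti ?_
        exact Finset.union_subset_union subset_rfl (Finset.product_subset_product
          (Finset.union_subset_union subset_rfl hI) subset_rfl)
      have e2 : ∀ I, (ulim (iterSet U (k + 1)) fun J => q (s ∪ (L ∪ I) ×ˢ J)) ≤
          ulim (iterSet U k) fun J => ulim U fun j =>
            q ((s ∪ (L ∪ I) ×ˢ J) ⊔ L ×ˢ {j}) := by
        intro I
        rw [ulim_iterSet_succ fun _ => h01 _,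
          hq.ulim_comm h01 (iterSet U k) U (fun J => s ∪ (L ∪ I) ×ˢ J) fun j => L ×ˢ {j}]
        refine ulim_mono (fun _ => ulim_mem fun _ => h01 _) (fun _ => ulim_mem fun _ => h01 _)
          fun j => ulim_mono (fun _ => h01 _) (fun _ => h01 _) fun J => hanti ?_
        intro p
        simp only [Finset.sup_eq_union, Finset.mem_union, Finset.mem_product, Finset.mem_insert,
          Finset.mem_singleton]
        tauto
      have e3 : (ulim (iterSet U k) fun I => ulim (iterSet U k) fun J =>
          ulim U fun j => q ((s ∪ (L ∪ I) ×ˢ J) ⊔ L ×ˢ {j})) =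
          ulim U fun j => ulim (iterSet U k) fun I =>
            ulim (iterSet U k) fun J => q ((s ∪ (L ∪ I) ×ˢ J) ⊔ L ×ˢ {j}) :=
        hq.ulim_pair_comm h01 _ _ _ (fun I J => s ∪ (L ∪ I) ×ˢ J) _
      refine e1.trans ((ulim_mono (fun _ => hm1 _ _ _)
        (fun _ => ulim_mem fun _ => ulim_mem fun _ => h01 _) e2).trans (e3.le.trans ?_))
      refine ulim_mono (fun i => ulim_mem fun _ => ulim_mem fun _ => h01 _)
        (fun i => patternLim_mem h01 _ _) fun j => le_trans (le_of_eq ?_) (ih _ _)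
      simp only [patternStep, Finset.sup_eq_union, Finset.union_right_comm]
      rfl

theorem SupPosDef.patternLim_pos (hq : SupPosDef q) (hanti : Antitone q)
    (h01 : ∀ s, q s ∈ Set.Icc (0 : ℝ) 1) (hU : (U : Filter ℕ) ≤ atTop) {δ : ℝ} (hδ : 0 < δ)
    (hqδ : ∀ i j, i < j → δ ≤ q {(i, j)}) {k : ℕ} (c : Fin k → Bool) :
    0 < patternLim U q c (∅, ∅) := by
  refine lt_of_lt_of_le ?_ (hq.le_patternLim hanti h01 c _)
  simp only [Finset.empty_union]
  obtain ⟨n, hn⟩ : ∃ n, n = 2 ^ k := ⟨_, rfl⟩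
  have hq₁m : ∀ I : Finset ℕ, (ulim U fun j => q (I ×ˢ {j})) ∈ Set.Icc (0 : ℝ) 1 :=
    fun I => ulim_mem fun _ => h01 _
  have h1 : ∀ I : Finset ℕ, (ulim U fun j => q (I ×ˢ {j})) ^ n ≤
      ulim (iterSet U k) fun J => q (I ×ˢ J) := fun I => by
    have hI : SupPosDef fun J : Finset ℕ => q (I ×ˢ J) :=
      hq.comp (fun J => I ×ˢ J) fun x y => Finset.product_union
    rw [hn]
    exact hI.pow_le_ulim_iterSet (fun _ => h01 _)
      (fun J J' h => hanti (Finset.product_subset_product subset_rfl h)) k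
  have hp : SupPosDef fun I : Finset ℕ => ulim U fun j => q (I ×ˢ {j}) :=
    SupPosDef.limit U (fun j => hq.comp (fun I : Finset ℕ => I ×ˢ ({j} : Finset ℕ))
      fun x y => Finset.union_product) fun _ _ => h01 _
  have h2 : δ ≤ ulim U fun i => ulim U fun j => q ({i} ×ˢ {j}) := by
    refine le_ulim (fun _ => hq₁m _) (Eventually.of_forall fun i => le_ulim (fun _ => h01 _) ?_)
    filter_upwards [hU (eventually_gt_atTop i)] with j hj
    simpa using hqδ i j hj
  have h3 := hp.pow_le_ulim_iterSet (U := U) hq₁m (fun I I' h => ulim_mono (fun _ => h01 _)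
    (fun _ => h01 _) fun j => hanti (Finset.product_subset_product h subset_rfl)) k
  rw [← hn] at h3
  refine (pow_pos ((pow_pos (hδ.trans_le h2) _).trans_le h3) n).trans_le ?_
  rw [← ulim_pow hq₁m]
  exact ulim_mono (fun I => ⟨pow_nonneg (hq₁m I).1 _, pow_le_one₀ (hq₁m I).1 (hq₁m I).2⟩)
    (fun _ => ulim_mem fun _ => h01 _) h1

end Pattern

theorem supPosDef_mul_sum {T P : Type} [SemilatticeSup P] (S : Finset T) (f : P → T → ℝ)
    (hf : ∀ x y u, f (x ⊔ y) u = f x u * f y u) {w : ℝ} (hw : 0 ≤ w) :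
    SupPosDef fun x => w * ∑ u ∈ S, f x u := by
  intro v
  have h : (v.sum fun x a => v.sum fun y b => (w * ∑ u ∈ S, f (x ⊔ y) u) * (a * b)) =
      w * ∑ u ∈ S, (v.sum fun x a => f x u * a) ^ 2 := by
    simp only [Finsupp.sum, sq, hf, Finset.sum_mul, Finset.mul_sum]
    refine Eq.symm (Finset.sum_comm.trans (Finset.sum_congr rfl fun x _ =>
      Finset.sum_comm.trans (Finset.sum_congr rfl fun y _ => Finset.sum_congr rfl fun u _ => ?_)))
    ring
  rw [h]
  exact mul_nonneg hw (Finset.sum_nonneg fun _ _ => sq_nonneg _)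

open Classical in
/-- If the sets `E i j`, for `i < j < M`, all have density at least `δ` in `S`, then there are
`x 0 < ⋯ < x (k - 1) < M` such that for every colouring `c` of the indices the sets
`E (x a) (x b)` with `a < b`, `c a = true` and `c b = false` have an intersection whose
density is bounded below in terms of `δ` and `k`. -/
theorem exists_pattern {δ : ℝ} (hδ : 0 < δ) (k : ℕ) : ∃ M : ℕ, ∃ p : ℝ, 0 < p ∧
    ∀ (T : Type) (S : Finset T) (E : ℕ → ℕ → T → Prop), S.Nonempty →
      (∀ i j, i < j → j < M → δ * S.card ≤ (S.filter (E i j)).card) →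
      ∃ x : Fin k → ℕ, StrictMono x ∧ (∀ a, x a < M) ∧ ∀ c : Fin k → Bool,
        p * S.card ≤ (S.filter fun u => ∀ a b, a < b → c a = true → c b = false →
          E (x a) (x b) u).card := by
  by_contra! H
  have H' := fun n : ℕ => H n (1 / (n + 1)) (by positivity)
  choose T S E hS hE hx using H'
  set q : ℕ → Finset (ℕ × ℕ) → ℝ := fun n s =>
    ((S n).filter fun u => ∀ p ∈ s, E n p.1 p.2 u).card / (S n).card with hq
  have hcard : ∀ n, (0 : ℝ) < (S n).card := fun n => by exact_mod_cast (hS n).card_pos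
  have hq_eq : ∀ n s, q n s = ((S n).filter fun u => ∀ p ∈ s, E n p.1 p.2 u).card / (S n).card :=
    fun n s => rfl
  have h01 : ∀ n s, q n s ∈ Set.Icc (0 : ℝ) 1 := by
    intro n s
    rw [hq_eq, Set.mem_Icc, div_le_one (hcard n)]
    exact ⟨by positivity, by exact_mod_cast Finset.card_filter_le _ _⟩
  have hqp : ∀ n, SupPosDef (q n) := by
    intro n
    have h1 := supPosDef_mul_sum (P := Finset (ℕ × ℕ)) (S n)
      (fun s u => if ∀ p ∈ s, E n p.1 p.2 u then (1 : ℝ) else 0) (fun x y u => by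
        simp only [Finset.sup_eq_union, Finset.forall_mem_union, ite_and, ite_mul, one_mul,
          zero_mul]) (inv_nonneg.2 (hcard n).le)
    convert h1 using 2 with s
    rw [hq_eq, Finset.card_filter, div_eq_inv_mul]
    push_cast
    rfl
  have hanti : ∀ n, Antitone (q n) := by
    intro n s t hst
    rw [hq_eq, hq_eq]
    gcongr
  set U : Ultrafilter ℕ := hyperfilter ℕ with hU
  have hUle : (U : Filter ℕ) ≤ atTop := Nat.hyperfilter_le_atTop
  have hm : ∀ s, (ulim U fun n => q n s) ∈ Set.Icc (0 : ℝ) 1 := fun s => ulim_mem fun n => h01 n s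
  obtain ⟨x, hxm, -, hxq⟩ := exists_patternSet_pos hUle hm (k := k)
    (Set.finite_singleton ((∅ : Finset ℕ), (∅ : Finset (ℕ × ℕ)))) (by
      rintro _ rfl c
      refine (SupPosDef.limit U hqp h01).patternLim_pos (fun s t hst => ulim_mono (fun n => h01 n _)
        (fun n => h01 n _) fun n => hanti n hst) hm hUle hδ (fun i j hij => ?_) c
      refine le_ulim (fun n => h01 n _) ?_
      filter_upwards [hUle (eventually_gt_atTop j)] with n hn
      rw [hq_eq, le_div_iff₀ (hcard n)]
      simpa using hE n i j hij hn) 0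
  have h1 : ∀ᶠ n : ℕ in (U : Filter ℕ), ∀ c : Fin k → Bool,
      (1 / ((n : ℝ) + 1)) < q n (patternSet c x (∅, ∅)) := by
    refine eventually_all.2 fun c => ?_
    refine Tendsto.eventually_lt ?_ (tendsto_ulim fun n => h01 n _) (hxq _ rfl c)
    exact tendsto_one_div_add_atTop_nhds_zero_nat.mono_left hUle
  have h2 : ∀ᶠ n in (U : Filter ℕ), ∀ a, x a < n :=
    eventually_all.2 fun a => hUle (eventually_gt_atTop _)
  obtain ⟨n, hn1, hn2⟩ := (h1.and h2).exists
  obtain ⟨c, hc⟩ := hx n x hxm hn2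
  refine hc.not_ge ?_
  have h3 := (hn1 c).le
  rw [hq_eq, le_div_iff₀ (hcard n)] at h3
  refine h3.trans ?_
  gcongr
  exact fun h a b hab ha hb => h _ (mk_mem_patternSet c x _ hab ha hb)

section Weights

variable {V : Type} [DecidableEq V]

theorem sum_powerset_prod_mul_prod_of_subset [Fintype V] (f : V → ℝ) (t : Finset V) :
    (∑ U : Finset V, if t ⊆ U then (∏ i ∈ U, f i) * ∏ i ∈ Finset.univ \ U, (1 - f i) else 0) =
      ∏ i ∈ t, f i := by
  have h := Finset.prod_add f (fun i => if i ∈ t then 0 else 1 - f i) Finset.univ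
  have h1 : ∏ i, (f i + if i ∈ t then 0 else 1 - f i) = ∏ i ∈ t, f i := by
    rw [← Finset.prod_subset (Finset.subset_univ t) (f := fun i => f i + if i ∈ t then 0 else 1 - f i)
      (fun i _ hi => by simp [hi])]
    exact Finset.prod_congr rfl fun i hi => by simp [hi]
  rw [← h1, h, Finset.powerset_univ]
  refine Finset.sum_congr rfl fun U _ => ?_
  split_ifs with htU
  · congr 1
    refine Finset.prod_congr rfl fun i hi => ?_
    rw [if_neg fun hit => (Finset.mem_sdiff.1 hi).2 (htU hit)]
  · obtain ⟨i, hit, hiU⟩ := Finset.not_subset.1 htU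
    rw [Finset.prod_eq_zero (s := Finset.univ \ U) (i := i) (by simp [hiU]) (by simp [hit]),
      mul_zero]

/-- The expected number of members of `𝓕` inside a random set that contains each `i`
independently with probability `f i`. -/
theorem sum_weight_mul_card_filter_subset [Fintype V] (f : V → ℝ) (𝓕 : Finset (Finset V)) :
    (∑ U : Finset V, ((∏ i ∈ U, f i) * ∏ i ∈ Finset.univ \ U, (1 - f i)) *
      ((𝓕.filter fun e => e ⊆ U).card : ℝ)) = ∑ e ∈ 𝓕, ∏ i ∈ e, f i := by
  refine Eq.symm ((Finset.sum_congr rfl fun e _ =>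
    (sum_powerset_prod_mul_prod_of_subset f e).symm).trans (Finset.sum_comm.trans
      (Finset.sum_congr rfl fun U _ => ?_)))
  rw [Finset.card_filter]
  push_cast
  rw [Finset.mul_sum]
  simp

theorem H3.uniformlyDense.le_sum_prod [Fintype V] {H : H3 V} {d η : ℝ}
    (h : H.uniformlyDense d η) {f : V → ℝ} (hf : ∀ i, f i ∈ Set.Icc (0 : ℝ) 1) :
    d * (∑ t ∈ Finset.powersetCard 3 Finset.univ, ∏ i ∈ t, f i) - η * (Fintype.card V : ℝ) ^ 3 ≤
      ∑ e ∈ H.edges, ∏ i ∈ e, f i := by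
  have h1 := sum_weight_mul_card_filter_subset f H.edges
  have h2 := sum_weight_mul_card_filter_subset f (Finset.powersetCard 3 Finset.univ)
  have h3 := sum_powerset_prod_mul_prod_of_subset f ∅
  simp only [Finset.empty_subset, if_true, Finset.prod_empty] at h3
  rw [← h1, ← h2]
  refine le_trans (le_of_eq ?_) (Finset.sum_le_sum fun U (_ : U ∈ Finset.univ) =>
    mul_le_mul_of_nonneg_left (h U) (mul_nonneg (Finset.prod_nonneg fun i _ => (hf i).1)
      (Finset.prod_nonneg fun i _ => sub_nonneg.2 (hf i).2)))
  simp only [mul_sub, Finset.sum_sub_distrib]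
  rw [← Finset.sum_mul, h3, one_mul, Finset.mul_sum]
  congr 1
  refine Finset.sum_congr rfl fun U _ => ?_
  have h4 : (Finset.powersetCard 3 Finset.univ).filter (fun e => e ⊆ U) =
      Finset.powersetCard 3 U := by
    ext e
    simp [Finset.mem_powersetCard, and_comm]
  rw [h4, Finset.card_powersetCard]
  ring

/-- The weighted number of ordered triples whose underlying set belongs to `𝓕`. -/
def triSum [Fintype V] (𝓕 : Finset (Finset V)) (f g h : V → ℝ) : ℝ :=
  ∑ x, ∑ y, ∑ z, if {x, y, z} ∈ 𝓕 then f x * g y * h z else 0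

theorem prod_insert_insert_singleton (g : V → ℝ) {x y z : V}
    (h : ({x, y, z} : Finset V).card = 3) : ∏ i ∈ ({x, y, z} : Finset V), g i = g x * g y * g z := by
  have hx : x ∉ ({y, z} : Finset V) := fun hx => by
    rw [Finset.insert_eq_of_mem hx] at h
    exact absurd Finset.card_le_two (by rw [h]; norm_num)
  have hy : y ∉ ({z} : Finset V) := fun hy => by
    rw [Finset.insert_eq_of_mem hy] at h
    exact absurd Finset.card_le_two (by rw [h]; norm_num)
  rw [Finset.prod_insert hx, Finset.prod_insert hy, Finset.prod_singleton, mul_assoc]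

variable [Fintype V] {𝓕 : Finset (Finset V)}

theorem triSum_eq (h𝓕 : ∀ e ∈ 𝓕, e.card = 3) (g : V → ℝ) :
    triSum 𝓕 g g g = ∑ e ∈ 𝓕, ((Finset.univ.filter fun p : V × V × V =>
      ({p.1, p.2.1, p.2.2} : Finset V) = e).card : ℝ) * ∏ i ∈ e, g i := by
  have h1 : triSum 𝓕 g g g = ∑ p ∈ Finset.univ.filter
      fun p : V × V × V => ({p.1, p.2.1, p.2.2} : Finset V) ∈ 𝓕, g p.1 * g p.2.1 * g p.2.2 := by
    rw [Finset.sum_filter, triSum, Fintype.sum_prod_type]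
    simp_rw [Fintype.sum_prod_type]
  rw [h1, ← Finset.sum_fiberwise_of_maps_to (t := 𝓕)
    (g := fun p : V × V × V => ({p.1, p.2.1, p.2.2} : Finset V)) (by simp)]
  refine Finset.sum_congr rfl fun e he => ?_
  rw [← nsmul_eq_mul, Finset.filter_filter]
  refine (Finset.sum_congr (s₂ := Finset.univ.filter fun p : V × V × V =>
    ({p.1, p.2.1, p.2.2} : Finset V) = e) ?_ ?_).trans (Finset.sum_const _)
  · ext p
    simp only [Finset.mem_filter, Finset.mem_univ, true_and, and_iff_right_iff_imp]
    rintro rfl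
    exact he
  · intro p hp
    obtain rfl := (Finset.mem_filter.1 hp).2
    exact (prod_insert_insert_singleton g (h𝓕 _ he)).symm

theorem sum_prod_le_triSum (h𝓕 : ∀ e ∈ 𝓕, e.card = 3) {g : V → ℝ} (hg : ∀ i, 0 ≤ g i) :
    ∑ e ∈ 𝓕, ∏ i ∈ e, g i ≤ triSum 𝓕 g g g := by
  rw [triSum_eq h𝓕]
  refine Finset.sum_le_sum fun e he => le_mul_of_one_le_left
    (Finset.prod_nonneg fun i _ => hg i) ?_
  obtain ⟨x, y, z, -, -, -, rfl⟩ := Finset.card_eq_three.1 (h𝓕 e he)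
  rw [Nat.one_le_cast, Nat.one_le_iff_ne_zero, Finset.card_ne_zero]
  exact ⟨(x, y, z), by simp⟩

theorem triSum_le_sum_prod (h𝓕 : ∀ e ∈ 𝓕, e.card = 3) {g : V → ℝ} (hg : ∀ i, 0 ≤ g i) :
    triSum 𝓕 g g g ≤ 27 * ∑ e ∈ 𝓕, ∏ i ∈ e, g i := by
  rw [triSum_eq h𝓕, Finset.mul_sum]
  refine Finset.sum_le_sum fun e he => mul_le_mul_of_nonneg_right ?_
    (Finset.prod_nonneg fun i _ => hg i)
  have h1 : (Finset.univ.filter fun p : V × V × V => ({p.1, p.2.1, p.2.2} : Finset V) = e) ⊆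
      e ×ˢ e ×ˢ e := by
    intro p hp
    obtain rfl := (Finset.mem_filter.1 hp).2
    simp
  have h2 := Finset.card_le_card h1
  rw [Finset.card_product, Finset.card_product, h𝓕 e he] at h2
  exact_mod_cast h2

theorem triSum_swap_left (f g h : V → ℝ) : triSum 𝓕 f g h = triSum 𝓕 g f h := by
  unfold triSum
  rw [Finset.sum_comm]
  refine Finset.sum_congr rfl fun x _ => Finset.sum_congr rfl fun y _ =>
    Finset.sum_congr rfl fun z _ => ?_
  rw [Finset.insert_comm, mul_comm (f y)]

theorem triSum_swap_right (f g h : V → ℝ) : triSum 𝓕 f g h = triSum 𝓕 f h g := by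
  unfold triSum
  refine Finset.sum_congr rfl fun x _ => ?_
  rw [Finset.sum_comm]
  refine Finset.sum_congr rfl fun y _ => Finset.sum_congr rfl fun z _ => ?_
  rw [Finset.pair_comm, mul_right_comm]

theorem triSum_sum_sum_sum {ι : Type} (s : Finset ι) (f : ι → V → ℝ) :
    triSum 𝓕 (fun x => ∑ i ∈ s, f i x) (fun x => ∑ i ∈ s, f i x) (fun x => ∑ i ∈ s, f i x) =
      ∑ i ∈ s, ∑ j ∈ s, ∑ l ∈ s, triSum 𝓕 (f i) (f j) (f l) := by
  have h1 : ∀ g h : V → ℝ, triSum 𝓕 (fun x => ∑ i ∈ s, f i x) g h = ∑ i ∈ s, triSum 𝓕 (f i) g h := by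
    intro g h
    unfold triSum
    refine Eq.symm (Finset.sum_comm.trans (Finset.sum_congr rfl fun x _ =>
      Finset.sum_comm.trans (Finset.sum_congr rfl fun y _ =>
        Finset.sum_comm.trans (Finset.sum_congr rfl fun z _ => ?_))))
    split_ifs
    · simp [Finset.sum_mul]
    · simp
  rw [h1]
  refine Finset.sum_congr rfl fun i _ => ?_
  rw [triSum_swap_left, h1]
  refine Finset.sum_congr rfl fun j _ => ?_
  rw [triSum_swap_left, triSum_swap_right, triSum_swap_left, h1]
  refine Finset.sum_congr rfl fun l _ => ?_
  rw [triSum_swap_left, triSum_swap_right]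

theorem triSum_le_mul {f g h : V → ℝ} (hf : ∀ i, 0 ≤ f i) (hg : ∀ i, 0 ≤ g i)
    (hh : ∀ i, 0 ≤ h i) : triSum 𝓕 f g h ≤ (∑ i, f i) * (∑ i, g i) * ∑ i, h i := by
  unfold triSum
  rw [Finset.sum_mul_sum, Finset.sum_mul]
  refine Finset.sum_le_sum fun x _ => ?_
  rw [Finset.sum_mul]
  refine Finset.sum_le_sum fun y _ => ?_
  rw [Finset.mul_sum]
  refine Finset.sum_le_sum fun z _ => ?_
  split_ifs
  · exact le_rfl
  · exact mul_nonneg (mul_nonneg (hf x) (hg y)) (hh z)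

theorem pow_three_sub_le_triSum {g : V → ℝ} (hg : ∀ i, 0 ≤ g i) {G : ℝ} (hG : ∀ i, g i ≤ G) :
    (∑ i, g i) ^ 3 - 3 * G * (∑ i, g i) ^ 2 ≤
      triSum (Finset.powersetCard 3 Finset.univ) g g g := by
  have h1 : (∑ i, g i) ^ 3 = ∑ x, ∑ y, ∑ z, g x * g y * g z := by
    rw [pow_succ, sq, Finset.sum_mul_sum, Finset.sum_mul]
    refine Finset.sum_congr rfl fun x _ => ?_
    rw [Finset.sum_mul]
    exact Finset.sum_congr rfl fun y _ => Finset.mul_sum _ _ _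
  have h2 : ∀ x y z, g x * g y * g z ≤ (if {x, y, z} ∈ Finset.powersetCard 3
      (Finset.univ : Finset V) then g x * g y * g z else 0) +
      ((if x = y then G * g y * g z else 0) + (if x = z then G * g y * g z else 0) +
        if y = z then G * g x * g z else 0) := by
    intro x y z
    have hyz := mul_nonneg (hg y) (hg z)
    have hxz := mul_nonneg (hg x) (hg z)
    have p1 : g x * g y * g z ≤ G * g y * g z := by nlinarith [hG x]
    have p2 : g x * g y * g z ≤ G * g x * g z := by nlinarith [hG y]
    have p3 : 0 ≤ g x * g y * g z := by nlinarith [mul_nonneg hyz (hg x)]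
    by_cases hxy : x = y
    · rw [if_pos hxy]
      split_ifs <;> linarith
    by_cases hxz : x = z
    · rw [if_pos hxz]
      split_ifs <;> linarith
    by_cases hyz : y = z
    · rw [if_pos hyz]
      split_ifs <;> linarith
    rw [if_pos (by simp [Finset.mem_powersetCard, Finset.card_eq_three.2 ⟨x, y, z, hxy, hxz, hyz, rfl⟩])]
    simp [hxy, hxz, hyz]
  have h3 := Finset.sum_le_sum fun x (_ : x ∈ Finset.univ) => Finset.sum_le_sum
    fun y (_ : y ∈ Finset.univ) => Finset.sum_le_sum fun z (_ : z ∈ Finset.univ) => h2 x y z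
  simp only [Finset.sum_add_distrib] at h3
  have e1 : ∑ x, ∑ y, ∑ z, (if x = y then G * g y * g z else 0) = G * (∑ i, g i) ^ 2 := by
    rw [Finset.sum_comm, sq, Finset.sum_mul_sum, Finset.mul_sum]
    refine Finset.sum_congr rfl fun y _ => ?_
    rw [Finset.sum_comm, Finset.mul_sum]
    simp [mul_assoc]
  have e2 : ∑ x, ∑ y, ∑ z, (if x = z then G * g y * g z else 0) = G * (∑ i, g i) ^ 2 := by
    rw [Finset.sum_comm, sq, Finset.sum_mul_sum, Finset.mul_sum]
    refine Finset.sum_congr rfl fun y _ => ?_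
    rw [Finset.sum_comm, Finset.mul_sum]
    simp [mul_assoc]
  have e3 : ∑ x, ∑ y, ∑ z, (if y = z then G * g x * g z else 0) = G * (∑ i, g i) ^ 2 := by
    rw [sq, Finset.sum_mul_sum, Finset.mul_sum]
    refine Finset.sum_congr rfl fun y _ => ?_
    rw [Finset.sum_comm, Finset.mul_sum]
    simp [mul_assoc]
  rw [e1, e2, e3, ← h1] at h3
  unfold triSum
  linarith

end Weights

section Sparsify

variable {V : Type}

/-- `T` contains no sequence of length `m` that is pairwise related by `Γ`. -/
def NoClique (Γ : V → V → Prop) (m : ℕ) (T : Finset V) : Prop :=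
  ¬ ∃ x : Fin m → V, (∀ a, x a ∈ T) ∧ ∀ a b, a < b → Γ (x a) (x b)

theorem NoClique.mono {Γ : V → V → Prop} {m : ℕ} {T T' : Finset V} (h : NoClique Γ m T)
    (hT : T' ⊆ T) : NoClique Γ m T' :=
  fun ⟨x, hx, hΓ⟩ => h ⟨x, fun a => hT (hx a), hΓ⟩

theorem NoClique.ne_zero {Γ : V → V → Prop} {m : ℕ} {T : Finset V} (h : NoClique Γ m T) :
    m ≠ 0 := by
  rintro rfl
  exact h ⟨Fin.elim0, fun a => a.elim0, fun a => a.elim0⟩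

open Classical in
theorem NoClique.filter {Γ : V → V → Prop} {m : ℕ} {T : Finset V} (h : NoClique Γ (m + 1) T)
    {y : V} (hy : y ∈ T) : NoClique Γ m (T.filter (Γ y)) := by
  rintro ⟨x, hx, hΓ⟩
  refine h ⟨Fin.cons y x, fun a => ?_, fun a b hab => ?_⟩
  · obtain rfl | ⟨a, rfl⟩ := a.eq_zero_or_eq_succ
    · simpa using hy
    · simpa using (Finset.mem_filter.1 (hx a)).1
  · obtain ⟨b, rfl⟩ := Fin.exists_succ_eq.2 (Fin.ne_zero_of_lt hab)
    obtain rfl | ⟨a, rfl⟩ := a.eq_zero_or_eq_succ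
    · simpa using (Finset.mem_filter.1 (hx b)).2
    · simpa using hΓ a b (Fin.succ_lt_succ_iff.1 hab)

open Classical in
theorem exists_sparse_subset {ι : Type} [Fintype ι] (Γ : ι → V → V → Prop) {ε : ℝ} (hε : 0 < ε)
    (hε1 : ε ≤ 1) (s : ℕ) (m : ι → ℕ) (hs : ∑ i, m i = s) (T : Finset V)
    (hm : ∀ i, NoClique (Γ i) (m i) T) :
    ∃ T' ⊆ T, ε ^ s * T.card ≤ T'.card ∧
      ∀ i, ∀ y ∈ T', ((T'.filter (Γ i y)).card : ℝ) ≤ ε * T'.card := by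
  induction s generalizing m T with
  | zero =>
    refine ⟨T, subset_rfl, by simp, fun i => ?_⟩
    exact absurd (Finset.sum_eq_zero_iff.1 hs i (Finset.mem_univ i)) (hm i).ne_zero
  | succ s ih =>
    by_cases h : ∀ i, ∀ y ∈ T, ((T.filter (Γ i y)).card : ℝ) ≤ ε * T.card
    · exact ⟨T, subset_rfl, mul_le_of_le_one_left (by positivity) (pow_le_one₀ hε.le hε1), h⟩
    push Not at h
    obtain ⟨i, y, hy, hlt⟩ := h
    obtain ⟨r, hr⟩ := Nat.exists_eq_succ_of_ne_zero (hm i).ne_zero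
    obtain ⟨T', hT', hcard, hdeg⟩ := ih (Function.update m i r) (by
        have h1 := Finset.sum_update_of_mem (Finset.mem_univ i) m r
        have h2 := Finset.add_sum_erase Finset.univ m (Finset.mem_univ i)
        rw [Finset.sdiff_singleton_eq_erase] at h1
        omega) (T.filter (Γ i y)) (by
        intro j
        by_cases hj : j = i
        · subst hj
          rw [Function.update_self]
          have := hm j
          rw [hr] at this
          exact this.filter hy
        · rw [Function.update_of_ne hj]
          exact (hm j).mono (Finset.filter_subset _ _))
    refine ⟨T', hT'.trans (Finset.filter_subset _ _), le_trans ?_ hcard, hdeg⟩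
    rw [pow_succ, mul_assoc]
    gcongr

open Classical in
theorem exists_sparse_chain [Fintype V] (Γ : Finset V → V → V → Prop) {ε : ℝ} (hε : 0 < ε)
    (hε1 : ε ≤ 1) (m K : ℕ)
    (hΓ : ∀ S : Finset V, ε ^ (m * K ^ 2) * Fintype.card V ≤ S.card →
      NoClique (Γ S) m Finset.univ) :
    ∀ k ≤ K, ∃ T : ℕ → Finset V, Antitone T ∧
      (∀ j, ε ^ (m * k ^ 2) * Fintype.card V ≤ (T j).card) ∧
      ∀ i j, i < j → j ≤ k → ∀ y ∈ T j,
        (((T j).filter (Γ (T i) y)).card : ℝ) ≤ ε * (T j).card := by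
  intro k
  induction k with
  | zero =>
    refine fun _ => ⟨fun _ => Finset.univ, antitone_const, by simp, fun i j hij hj => ?_⟩
    omega
  | succ k ih =>
    intro hk
    obtain ⟨T, hT, hcard, hdeg⟩ := ih (by omega)
    have hpow : ε ^ (m * K ^ 2) ≤ ε ^ (m * k ^ 2) :=
      pow_le_pow_of_le_one hε.le hε1 (Nat.mul_le_mul_left _ (Nat.pow_le_pow_left (by omega) _))
    obtain ⟨T', hT', hcard', hdeg'⟩ := exists_sparse_subset (fun i : Fin (k + 1) => Γ (T i)) hε hε1
      ((k + 1) * m) (fun _ => m) (by simp) (T k) fun i =>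
        (hΓ (T i) (le_trans (by gcongr) (hcard i))).mono (Finset.subset_univ _)
    have hcard2 : ε ^ (m * (k + 1) ^ 2) * Fintype.card V ≤ T'.card := by
      refine le_trans ?_ ((mul_le_mul_of_nonneg_left (hcard k) (by positivity)).trans hcard')
      rw [← mul_assoc, ← pow_add]
      refine mul_le_mul_of_nonneg_right (pow_le_pow_of_le_one hε.le hε1 ?_) (by positivity)
      nlinarith [Nat.zero_le (m * k)]
    refine ⟨fun j => if j ≤ k then T j else T', fun i j hij => ?_, fun j => ?_, ?_⟩
    · change (if j ≤ k then T j else T') ⊆ if i ≤ k then T i else T'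
      split_ifs with h1 h2 h2
      · exact hT hij
      · omega
      · exact hT'.trans (hT h2)
      · exact subset_rfl
    · change _ ≤ (((if j ≤ k then T j else T').card : ℕ) : ℝ)
      split_ifs
      · refine le_trans ?_ (hcard j)
        refine mul_le_mul_of_nonneg_right (pow_le_pow_of_le_one hε.le hε1 ?_) (by positivity)
        gcongr
        omega
      · exact hcard2
    · intro i j hij hj
      beta_reduce
      rw [if_pos (show i ≤ k by omega)]
      by_cases hjk : j ≤ k
      · rw [if_pos hjk]
        exact hdeg i j hij hjk
      · rw [if_neg hjk]
        exact hdeg' ⟨i, by omega⟩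

end Sparsify

section Density

variable {V : Type} [DecidableEq V]

/-- The normalised indicator function of `T`. -/
noncomputable def unifWeight (T : Finset V) (x : V) : ℝ := if x ∈ T then (T.card : ℝ)⁻¹ else 0

theorem unifWeight_nonneg (T : Finset V) (x : V) : 0 ≤ unifWeight T x := by
  unfold unifWeight
  split_ifs <;> positivity

variable [Fintype V]

theorem sum_unifWeight {T : Finset V} (hT : T.Nonempty) : ∑ x, unifWeight T x = 1 := by
  have : (T.card : ℝ) ≠ 0 := by exact_mod_cast hT.card_ne_zero
  simp [unifWeight, Finset.sum_ite_mem, this]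

theorem sum_unifWeight_mul (T : Finset V) (g : V → ℝ) :
    ∑ x, unifWeight T x * g x = (T.card : ℝ)⁻¹ * ∑ x ∈ T, g x := by
  simp [unifWeight, ite_mul, Finset.sum_ite_mem, Finset.mul_sum]

/-- The number of edges of `H` that consist of `x`, `y` and an element of `S`. -/
def H3.codegIn (H : H3 V) (S : Finset V) (x y : V) : ℕ :=
  (S.filter fun u => {x, y, u} ∈ H.edges).card

open Classical in
theorem triSum_le_of_sparse (H : H3 V) {ε δ : ℝ} (hδ : 0 ≤ δ) {S T R : Finset V}
    (hS : S.Nonempty) (hT : T.Nonempty) (hR : R.Nonempty) (hRT : R ⊆ T)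
    (h : ∀ z ∈ T, ((T.filter fun y => δ * S.card ≤ H.codegIn S z y).card : ℝ) ≤ ε * T.card) :
    triSum H.edges (unifWeight S) (unifWeight T) (unifWeight R) ≤ ε + δ := by
  have hS' : (0 : ℝ) < S.card := by exact_mod_cast hS.card_pos
  have hT' : (0 : ℝ) < T.card := by exact_mod_cast hT.card_pos
  rw [triSum_swap_left, triSum_swap_right, triSum_swap_left]
  have key : ∀ z ∈ T, ∑ y, unifWeight T y * ((S.card : ℝ)⁻¹ * H.codegIn S z y) ≤ ε + δ := by
    intro z hz
    have h1 : ∀ y, (S.card : ℝ)⁻¹ * H.codegIn S z y ≤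
        (if δ * S.card ≤ H.codegIn S z y then 1 else 0) + δ := by
      intro y
      have h2 : (H.codegIn S z y : ℝ) ≤ S.card := by
        exact_mod_cast Finset.card_filter_le _ _
      rw [inv_mul_le_iff₀ hS']
      split_ifs with h3
      · nlinarith
      · nlinarith
    calc _ ≤ ∑ y, unifWeight T y * ((if δ * S.card ≤ H.codegIn S z y then 1 else 0) + δ) :=
          Finset.sum_le_sum fun y _ => mul_le_mul_of_nonneg_left (h1 y) (unifWeight_nonneg T y)
      _ = (T.card : ℝ)⁻¹ * (T.filter fun y => δ * S.card ≤ H.codegIn S z y).card + δ := by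
          simp_rw [mul_add, Finset.sum_add_distrib, ← Finset.sum_mul, sum_unifWeight hT,
            sum_unifWeight_mul, Finset.card_filter]
          push_cast
          ring
      _ ≤ ε + δ := by
          gcongr
          rw [inv_mul_le_iff₀ hT', mul_comm (T.card : ℝ)]
          exact h z hz
  have e : triSum H.edges (unifWeight R) (unifWeight T) (unifWeight S) =
      ∑ z, unifWeight R z * ∑ y, unifWeight T y * ((S.card : ℝ)⁻¹ * H.codegIn S z y) := by
    unfold triSum
    refine Finset.sum_congr rfl fun z _ => ?_
    rw [Finset.mul_sum]
    refine Finset.sum_congr rfl fun y _ => ?_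
    have h1 := sum_unifWeight_mul S fun x => if {z, y, x} ∈ H.edges then (1 : ℝ) else 0
    rw [H3.codegIn, Finset.card_filter]
    push_cast
    rw [← h1, Finset.mul_sum, Finset.mul_sum]
    refine Finset.sum_congr rfl fun x _ => ?_
    split_ifs <;> ring
  rw [e, ← one_mul (ε + δ), ← sum_unifWeight hR, Finset.sum_mul]
  refine Finset.sum_le_sum fun z _ => ?_
  by_cases hz : z ∈ R
  · exact mul_le_mul_of_nonneg_left (key z (hRT hz)) (unifWeight_nonneg R z)
  · simp [unifWeight, hz]

end Density

theorem triSum_sum_unifWeight_le {V : Type} [DecidableEq V] [Fintype V] (H : H3 V)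
    {T : ℕ → Finset V} (hT : ∀ i, (T i).Nonempty) {s : ℕ} {b : ℝ} (hb : 0 ≤ b)
    (h : ∀ i j l, i < j → j < l → l < s →
      triSum H.edges (unifWeight (T i)) (unifWeight (T j)) (unifWeight (T l)) ≤ b) :
    triSum H.edges (fun x => ∑ i ∈ Finset.range s, unifWeight (T i) x)
      (fun x => ∑ i ∈ Finset.range s, unifWeight (T i) x)
      (fun x => ∑ i ∈ Finset.range s, unifWeight (T i) x) ≤ b * s ^ 3 + 3 * s ^ 2 := by
  rw [triSum_sum_sum_sum]
  have h1 : ∀ i j l, triSum H.edges (unifWeight (T i)) (unifWeight (T j)) (unifWeight (T l)) ≤ 1 := by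
    intro i j l
    refine (triSum_le_mul (unifWeight_nonneg _) (unifWeight_nonneg _)
      (unifWeight_nonneg _)).trans_eq ?_
    simp [sum_unifWeight (hT _)]
  have h2 : ∀ i ∈ Finset.range s, ∀ j ∈ Finset.range s, ∀ l ∈ Finset.range s,
      triSum H.edges (unifWeight (T i)) (unifWeight (T j)) (unifWeight (T l)) ≤
        b + ((if i = j then 1 else 0) + (if i = l then 1 else 0) + if j = l then 1 else 0) := by
    intro i hi j hj l hl
    rw [Finset.mem_range] at hi hj hl
    have h3 := h1 i j l
    by_cases hij : i = j
    · rw [if_pos hij]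
      split_ifs <;> linarith
    by_cases hil : i = l
    · rw [if_pos hil]
      split_ifs <;> linarith
    by_cases hjl : j = l
    · rw [if_pos hjl]
      split_ifs; linarith
    simp only [hij, hil, hjl, if_false, add_zero]
    rcases lt_or_gt_of_ne hij with h4 | h4 <;> rcases lt_or_gt_of_ne hil with h5 | h5 <;>
      rcases lt_or_gt_of_ne hjl with h6 | h6
    · exact h i j l h4 h6 hl
    · rw [triSum_swap_right]
      exact h i l j h5 h6 hj
    · omega
    · rw [triSum_swap_right, triSum_swap_left]
      exact h l i j h5 h4 hj
    · rw [triSum_swap_left]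
      exact h j i l h4 h5 hl
    · omega
    · rw [triSum_swap_left, triSum_swap_right]
      exact h j l i h6 h5 hi
    · rw [triSum_swap_left, triSum_swap_right, triSum_swap_left]
      exact h l j i h6 h4 hi
  refine (Finset.sum_le_sum fun i hi => Finset.sum_le_sum fun j hj =>
    Finset.sum_le_sum fun l hl => h2 i hi j hj l hl).trans_eq ?_
  have e1 : ∀ i ∈ Finset.range s, ∀ j ∈ Finset.range s, (∑ l ∈ Finset.range s,
      (b + ((if i = j then 1 else 0) + (if i = l then 1 else 0) + if j = l then (1 : ℝ) else 0))) =
      s * b + s * (if i = j then 1 else 0) + 2 := by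
    intro i hi j hj
    simp only [Finset.sum_add_distrib, Finset.sum_const, Finset.card_range, nsmul_eq_mul,
      Finset.sum_ite_eq, hi, hj, if_true]
    ring
  rw [Finset.sum_congr rfl fun i hi => Finset.sum_congr rfl fun j hj => e1 i hi j hj]
  have e2 : ∀ i ∈ Finset.range s, (∑ j ∈ Finset.range s,
      (s * b + s * (if i = j then 1 else 0) + 2)) = s * (s * b) + s + s * 2 := by
    intro i hi
    simp only [Finset.sum_add_distrib, Finset.sum_const, Finset.card_range, nsmul_eq_mul,
      ← Finset.mul_sum, Finset.sum_ite_eq, hi, if_true, mul_one]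
  rw [Finset.sum_congr rfl fun i hi => e2 i hi]
  simp only [Finset.sum_const, Finset.card_range, nsmul_eq_mul]
  ring

theorem exists_codegree_clique {d : ℝ} (hd : 0 < d) (hd1 : d ≤ 1) (M : ℕ) :
    ∃ c : ℝ, 0 < c ∧ ∃ η : ℝ, 0 < η ∧ ∃ n₀ : ℕ, ∀ n, n₀ ≤ n → ∀ H : H3 (Fin n),
      H.uniformlyDense d η → ∃ S : Finset (Fin n), c * n ≤ S.card ∧ ∃ x : Fin M → Fin n,
        ∀ a b, a < b → d / 400 * S.card ≤ H.codegIn S (x a) (x b) := by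
  set ε : ℝ := d / 400 with hεd
  have hε : 0 < ε := by positivity
  have hε1 : ε ≤ 1 := by rw [hεd]; linarith
  set s : ℕ := ⌈1200 / d⌉₊ + 1 with hs
  have hsd : 1200 ≤ d * s := by
    have := Nat.le_ceil (1200 / d)
    rw [div_le_iff₀ hd] at this
    rw [hs]
    push_cast
    nlinarith
  have hs0 : (0 : ℝ) < s := by positivity
  obtain ⟨c, hc⟩ : ∃ c, c = ε ^ (M * s ^ 2) := ⟨_, rfl⟩
  have hc0 : 0 < c := hc ▸ pow_pos hε _
  refine ⟨c, hc0, c ^ 3 * ε, by positivity, ⌈6 / c⌉₊ + 1, fun n hn H hH => ?_⟩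
  by_contra! hno
  have hn6 : 6 ≤ c * n := by
    have h1 := Nat.le_ceil (6 / c)
    rw [div_le_iff₀ hc0] at h1
    have h2 : ((⌈6 / c⌉₊ : ℕ) : ℝ) ≤ n := by exact_mod_cast (by omega : ⌈6 / c⌉₊ ≤ n)
    nlinarith
  have hτ : 0 < c * n := by linarith
  obtain ⟨T, hT, hTc, hTd⟩ := exists_sparse_chain
    (fun (S : Finset (Fin n)) y z => ε * S.card ≤ H.codegIn S y z) hε hε1 M s (by
      rintro S hS ⟨x, -, hx⟩
      rw [← hc, Fintype.card_fin] at hS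
      obtain ⟨a, b, hab, hlt⟩ := hno S hS x
      exact hlt.not_ge (hx a b hab)) s le_rfl
  rw [← hc, Fintype.card_fin] at hTc
  have hTne : ∀ i, (T i).Nonempty := fun i => by
    rw [← Finset.card_pos]
    exact_mod_cast hτ.trans_le (hTc i)
  set g : Fin n → ℝ := fun x => ∑ i ∈ Finset.range s, unifWeight (T i) x with hg
  have hupper : triSum H.edges g g g ≤ (ε + ε) * s ^ 3 + 3 * s ^ 2 := by
    refine triSum_sum_unifWeight_le H hTne (by positivity) fun i j l hij hjl hl => ?_
    refine triSum_le_of_sparse H hε.le (hTne i) (hTne j) (hTne l) (hT hjl.le) fun z hz => ?_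
    convert hTd i j hij (by omega) z hz
  have hg0 : ∀ x, 0 ≤ g x := fun x => Finset.sum_nonneg fun i _ => unifWeight_nonneg _ _
  have hgG : ∀ x, g x ≤ s / (c * n) := by
    intro x
    refine (Finset.sum_le_card_nsmul (Finset.range s) _ (c * n)⁻¹ fun i _ => ?_).trans_eq ?_
    · unfold unifWeight
      split_ifs
      · exact inv_anti₀ hτ (hTc i)
      · positivity
    · rw [Finset.card_range, nsmul_eq_mul, div_eq_mul_inv]
  have hgs : ∑ x, g x = s := by
    rw [hg, Finset.sum_comm]
    simp [sum_unifWeight (hTne _)]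
  have hcard : ∀ t ∈ Finset.powersetCard 3 (Finset.univ : Finset (Fin n)), t.card = 3 :=
    fun t ht => (Finset.mem_powersetCard.1 ht).2
  have hlower := (pow_three_sub_le_triSum hg0 hgG).trans (triSum_le_sum_prod hcard hg0)
  rw [hgs] at hlower
  have hupper' := (sum_prod_le_triSum H.card3 hg0).trans hupper
  have hdense := hH.le_sum_prod (f := fun x => c * n / s * g x) fun x =>
    ⟨mul_nonneg (by positivity) (hg0 x), by
      have := hgG x
      rw [le_div_iff₀ hτ] at this
      rw [div_mul_eq_mul_div, div_le_one hs0]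
      linarith⟩
  have hscale : ∀ 𝓕 : Finset (Finset (Fin n)), (∀ e ∈ 𝓕, e.card = 3) →
      ∑ e ∈ 𝓕, ∏ i ∈ e, (c * n / s * g i) = (c * n / s) ^ 3 * ∑ e ∈ 𝓕, ∏ i ∈ e, g i := by
    intro 𝓕 h𝓕
    rw [Finset.mul_sum]
    refine Finset.sum_congr rfl fun e he => ?_
    rw [Finset.prod_mul_distrib, Finset.prod_const, h𝓕 e he]
  rw [hscale _ hcard, hscale _ H.card3, Fintype.card_fin] at hdense
  set P := ∑ t ∈ Finset.powersetCard 3 (Finset.univ : Finset (Fin n)), ∏ i ∈ t, g i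
  set Q := ∑ e ∈ H.edges, ∏ i ∈ e, g i
  have hdense' : d * P - ε * s ^ 3 ≤ Q := by
    have h1 : 0 < (c * n / s) ^ 3 := by positivity
    refine le_of_mul_le_mul_left ?_ h1
    refine le_trans (le_of_eq ?_) hdense
    field_simp
  have hP : (s : ℝ) ^ 3 ≤ 54 * P := by
    have h1 : 3 * ((s : ℝ) / (c * n)) * s ^ 2 ≤ s ^ 3 / 2 := by
      rw [mul_div_assoc', div_mul_eq_mul_div, div_le_iff₀ hτ]
      nlinarith [pow_pos hs0 3]
    linarith
  have hfin : d * s ^ 3 ≤ 54 * (3 * ε * s ^ 3 + 3 * s ^ 2) := by nlinarith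
  have hs2 : 1200 * (s : ℝ) ^ 2 ≤ d * s ^ 3 := by nlinarith [pow_pos hs0 2]
  have hds : 0 < d * (s : ℝ) ^ 3 := by positivity
  have hεs : ε * (s : ℝ) ^ 3 = d * s ^ 3 / 400 := by rw [hεd]; ring
  nlinarith

section UpperBound

variable {V : Type} [DecidableEq V] {F : H3 V} {A B : Finset V}

theorem exists_eq_of_type (hcover : ∀ v, v ∈ A ∨ v ∈ B) {e : Finset V}
    (hA : (e ∩ A).card = 2) (hB : (e ∩ B).card = 1) {k : ℕ} (σ : {x : V // x ∈ A} ≃ Fin k) :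
    ∃ x y : {x : V // x ∈ A}, ∃ u ∈ B, σ x < σ y ∧ e = {(x : V), (y : V), u} := by
  obtain ⟨x, y, hxy, hxyA⟩ := Finset.card_eq_two.1 hA
  obtain ⟨u, hu⟩ := Finset.card_eq_one.1 hB
  have he : e = {x, y, u} := by
    have h1 : e = e ∩ A ∪ e ∩ B := by
      rw [← Finset.inter_union_distrib_left, eq_comm, Finset.inter_eq_left]
      exact fun v _ => Finset.mem_union.2 (hcover v)
    rw [h1, hxyA, hu, Finset.insert_union, Finset.singleton_union]
  have hx : x ∈ A := (Finset.mem_inter.1 (hxyA ▸ Finset.mem_insert_self x {y})).2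
  have hy : y ∈ A := (Finset.mem_inter.1
    (hxyA ▸ Finset.mem_insert_of_mem (Finset.mem_singleton_self y))).2
  have huB : u ∈ B := (Finset.mem_inter.1 (hu ▸ Finset.mem_singleton_self u)).2
  have hne : σ ⟨x, hx⟩ ≠ σ ⟨y, hy⟩ := fun h => hxy (congrArg Subtype.val (σ.injective h))
  rcases lt_or_gt_of_ne hne with h | h
  · exact ⟨⟨x, hx⟩, ⟨y, hy⟩, u, huB, h, he⟩
  · exact ⟨⟨y, hy⟩, ⟨x, hx⟩, u, huB, h, he.trans (Finset.insert_comm _ _ _)⟩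

open Classical in
/-- Places the vertices of `A` at `X ∘ σ` and greedily chooses images for the vertices of `B`. -/
theorem H3.contains_of_pattern [Fintype V] (hcover : ∀ v, v ∈ A ∨ v ∈ B)
    (htype : ∀ e ∈ F.edges, (e ∩ A).card = 2 ∧ (e ∩ B).card = 1)
    {W : Type} [DecidableEq W] {H : H3 W} {k : ℕ} (σ : {x : V // x ∈ A} ≃ Fin k)
    (hσ : ∀ u ∈ B, ∀ x y z : {x : V // x ∈ A}, ({(x : V), (y : V), u} : Finset V) ∈ F.edges →
      ({(y : V), (z : V), u} : Finset V) ∈ F.edges → σ x < σ y → ¬σ y < σ z)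
    {X : Fin k → W} (hX : Function.Injective X) (S : Finset W)
    (hS : ∀ c : Fin k → Bool, k + B.card ≤ (S.filter fun u => ∀ a b, a < b → c a = true →
      c b = false → {X a, X b, u} ∈ H.edges).card) : H.contains F := by
  set c : V → Fin k → Bool := fun u a => decide (∃ x y : {x : V // x ∈ A}, σ x = a ∧ σ x < σ y ∧
    ({(x : V), (y : V), u} : Finset V) ∈ F.edges) with hc
  set N : {u // u ∈ B} → Finset W := fun u => (S.filter fun w => ∀ a b, a < b → c u a = true →
    c u b = false → {X a, X b, w} ∈ H.edges) \ Finset.univ.image X with hN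
  have hNcard : ∀ u, B.card ≤ (N u).card := by
    intro u
    have h1 := Finset.le_card_sdiff (Finset.univ.image X) (S.filter fun w => ∀ a b, a < b →
      c u a = true → c u b = false → {X a, X b, w} ∈ H.edges)
    rw [Finset.card_image_of_injective _ hX, Finset.card_univ, Fintype.card_fin] at h1
    have h2 := hS (c u)
    exact le_trans (by omega) h1
  obtain ⟨φ, hφ, hφN⟩ := (Finset.all_card_le_biUnion_card_iff_exists_injective N).1 fun s => by
    obtain rfl | ⟨u, hu⟩ := s.eq_empty_or_nonempty
    · simp
    · refine le_trans ?_ ((hNcard u).trans (Finset.card_le_card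
        (Finset.subset_biUnion_of_mem N hu)))
      simpa using Finset.card_le_univ s
  set f : V → W := fun v => if h : v ∈ A then X (σ ⟨v, h⟩) else φ ⟨v, (hcover v).resolve_left h⟩
    with hf
  have hφX : ∀ u a, φ u ≠ X a := fun u a h => (Finset.mem_sdiff.1 (hφN u)).2
    (h ▸ Finset.mem_image_of_mem X (Finset.mem_univ a))
  refine ⟨f, fun v w hvw => ?_, fun e he => ?_⟩
  · simp only [hf] at hvw
    split_ifs at hvw with h1 h2 h2
    · exact congrArg Subtype.val (σ.injective (hX hvw))
    · exact absurd hvw.symm (hφX _ _)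
    · exact absurd hvw (hφX _ _)
    · exact congrArg Subtype.val (hφ hvw)
  · obtain ⟨x, y, u, hu, hxy, rfl⟩ := exists_eq_of_type hcover (htype e he).1 (htype e he).2 σ
    have huA : u ∉ A := by
      intro huA
      have h1 : ({(x : V), (y : V), u} : Finset V) ∩ A = {(x : V), (y : V), u} := by
        rw [Finset.inter_eq_left]
        intro v hv
        simp only [Finset.mem_insert, Finset.mem_singleton] at hv
        rcases hv with rfl | rfl | rfl
        exacts [x.2, y.2, huA]
      have h2 := (htype _ he).1
      rw [h1, F.card3 _ he] at h2
      omega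
    have hfu : f u = φ ⟨u, hu⟩ := dif_neg huA
    have hfA : ∀ x : {x : V // x ∈ A}, f x = X (σ x) := fun x => dif_pos x.2
    rw [Finset.image_insert, Finset.image_insert, Finset.image_singleton, hfu, hfA, hfA]
    refine (Finset.mem_filter.1 (Finset.mem_sdiff.1 (hφN ⟨u, hu⟩)).1).2 _ _ hxy ?_ ?_
    · exact decide_eq_true ⟨x, y, rfl, hxy, he⟩
    · refine decide_eq_false ?_
      rintro ⟨y', z, hy', hyz, hez⟩
      obtain rfl := σ.injective hy'
      exact hσ u hu x y' z he hez hxy hyz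

theorem uniformTuranDensity_nonpos [Fintype V] (hcover : ∀ v, v ∈ A ∨ v ∈ B)
    (htype : ∀ e ∈ F.edges, (e ∩ A).card = 2 ∧ (e ∩ B).card = 1)
    {k : ℕ} (σ : {x : V // x ∈ A} ≃ Fin k)
    (hσ : ∀ u ∈ B, ∀ x y z : {x : V // x ∈ A}, ({(x : V), (y : V), u} : Finset V) ∈ F.edges →
      ({(y : V), (z : V), u} : Finset V) ∈ F.edges → σ x < σ y → ¬σ y < σ z) :
    uniformTuranDensity F ≤ 0 := by
  classical
  refine Real.sSup_nonpos ?_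
  rintro d ⟨-, hd1, hd⟩
  by_contra! hd0
  obtain ⟨M, p, hp, hpat⟩ := exists_pattern (δ := d / 400) (by positivity) k
  obtain ⟨c, hc, η, hη, n₀, hcl⟩ := exists_codegree_clique hd0 hd1 M
  obtain ⟨n, hn, H, hfree, hH⟩ := hd η hη (max n₀ (⌈(k + B.card) / (p * c)⌉₊ + 1))
  obtain ⟨S, hS, x, hx⟩ := hcl n ((le_max_left _ _).trans hn) H hH
  have hn1 : (k + B.card : ℝ) / (p * c) ≤ n := (Nat.le_ceil _).trans (by
    exact_mod_cast (Nat.le_succ _).trans ((le_max_right _ _).trans hn))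
  have hn0 : 0 < n := by have := (le_max_right _ _).trans hn; omega
  have hSpos : (0 : ℝ) < S.card := lt_of_lt_of_le (by positivity) hS
  obtain ⟨y, hy, hyM, hyc⟩ := hpat (Fin n) S
    (fun i j u => ∀ (hi : i < M) (hj : j < M), {x ⟨i, hi⟩, x ⟨j, hj⟩, u} ∈ H.edges)
    (Finset.card_pos.1 (by exact_mod_cast hSpos)) fun i j hij hj => by
      refine (hx ⟨i, hij.trans hj⟩ ⟨j, hj⟩ hij).trans ?_
      rw [H3.codegIn]
      gcongr with u
      exact fun h _ _ => h
  refine hfree (H3.contains_of_pattern hcover htype σ hσ (X := fun a => x ⟨y a, hyM a⟩) ?_ S ?_)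
  · have h1 : ∀ a b, a < b → x ⟨y a, hyM a⟩ ≠ x ⟨y b, hyM b⟩ := by
      intro a b hab heq
      have h2 := hx ⟨y a, hyM a⟩ ⟨y b, hyM b⟩ (hy hab)
      have h3 : 0 < H.codegIn S (x ⟨y a, hyM a⟩) (x ⟨y b, hyM b⟩) := by
        have : 0 < d / 400 * S.card := by positivity
        exact_mod_cast this.trans_le h2
      obtain ⟨u, hu⟩ := Finset.card_pos.1 h3
      have h4 := H.card3 _ (Finset.mem_filter.1 hu).2
      rw [heq, Finset.insert_eq_of_mem (Finset.mem_insert_self _ _)] at h4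
      have := Finset.card_le_two (a := x ⟨y b, hyM b⟩) (b := u)
      omega
    intro a b hab
    by_contra hne
    rcases lt_or_gt_of_ne hne with h | h
    · exact h1 a b h hab
    · exact h1 b a h hab.symm
  · intro c'
    have h1 : ((k + B.card : ℕ) : ℝ) ≤ p * S.card := by
      rw [div_le_iff₀ (by positivity)] at hn1
      push_cast
      nlinarith
    have h2 := h1.trans (hyc c')
    refine (Nat.cast_le.1 h2).trans (Finset.card_le_card ?_)
    convert Finset.monotone_filter_right S (p := fun u => ∀ a b, a < b → c' a = true →
      c' b = false → ∀ (hi : y a < M) (hj : y b < M), {x ⟨y a, hi⟩, x ⟨y b, hj⟩, u} ∈ H.edges)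
      fun u _ hu a b hab ha hb => hu a b hab ha hb (hyM a) (hyM b)

end UpperBound

section LowerBound

open Classical in
/-- The 3-graph of all triples `i < j < k` with `φ i j = 0`, `φ j k = 1` and `φ i k = 2`. -/
noncomputable def rainbowH3 {n : ℕ} (φ : Fin n → Fin n → Fin 3) : H3 (Fin n) where
  edges := Finset.univ.filter fun e => ∃ i j k, i < j ∧ j < k ∧ e = {i, j, k} ∧
    φ i j = 0 ∧ φ j k = 1 ∧ φ i k = 2
  card3 e he := by
    obtain ⟨i, j, k, hij, hjk, rfl, -⟩ := (Finset.mem_filter.1 he).2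
    exact Finset.card_eq_three.2 ⟨i, j, k, hij.ne, (hij.trans hjk).ne, hjk.ne, rfl⟩

theorem eq_of_sorted_triple_eq {α : Type*} [LinearOrder α] {i j k i' j' k' : α}
    (hij : i < j) (hjk : j < k) (hij' : i' < j') (hjk' : j' < k')
    (h : ({i, j, k} : Finset α) = {i', j', k'}) : i = i' ∧ j = j' ∧ k = k' := by
  have h1 : ∀ a, a = i ∨ a = j ∨ a = k ↔ a = i' ∨ a = j' ∨ a = k' := fun a => by
    simpa using Finset.ext_iff.1 h a
  have hi := (h1 i).1 (Or.inl rfl)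
  have hj := (h1 j).1 (Or.inr (Or.inl rfl))
  have hk := (h1 k).1 (Or.inr (Or.inr rfl))
  have hi' := (h1 i').2 (Or.inl rfl)
  have hk' := (h1 k').2 (Or.inr (Or.inr rfl))
  grind

theorem mem_rainbowH3 {n : ℕ} {φ : Fin n → Fin n → Fin 3} {i j k : Fin n} (hij : i < j)
    (hjk : j < k) :
    {i, j, k} ∈ (rainbowH3 φ).edges ↔ φ i j = 0 ∧ φ j k = 1 ∧ φ i k = 2 := by
  refine Finset.mem_filter.trans ⟨?_, fun h => ⟨Finset.mem_univ _, i, j, k, hij, hjk, rfl, h⟩⟩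
  rintro ⟨-, i', j', k', hij', hjk', h, hφ⟩
  obtain ⟨rfl, rfl, rfl⟩ := eq_of_sorted_triple_eq hij hjk hij' hjk' h
  exact hφ

theorem not_mem_rainbowH3_of_lt_of_lt {n : ℕ} {φ : Fin n → Fin n → Fin 3} {x y z u : Fin n}
    (hxy : x < y) (hyz : y < z) (h1 : {x, y, u} ∈ (rainbowH3 φ).edges) :
    {y, z, u} ∉ (rainbowH3 φ).edges := by
  intro h2
  have hne : ∀ {a b : Fin n}, {a, b, u} ∈ (rainbowH3 φ).edges → a ≠ u ∧ b ≠ u := by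
    refine fun {a b} h => ⟨?_, ?_⟩ <;> rintro rfl <;> have h3 := (rainbowH3 φ).card3 _ h
    · have := Finset.card_le_two (a := a) (b := b)
      rw [Finset.pair_comm, Finset.insert_comm, Finset.insert_eq_of_mem (by simp)] at h3
      omega
    · have := Finset.card_le_two (a := a) (b := b)
      rw [Finset.pair_eq_singleton] at h3
      omega
  obtain ⟨hxu, hyu⟩ := hne h1
  obtain ⟨-, hzu⟩ := hne h2
  rcases lt_or_gt_of_ne hyu with hyu | huy
  · have h3 := ((mem_rainbowH3 hxy hyu).1 h1).2.1
    rcases lt_or_gt_of_ne hzu with hzu | huz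
    · have h4 := ((mem_rainbowH3 hyz hzu).1 h2).2.2
      simp [h3] at h4
    · rw [Finset.pair_comm] at h2
      have h4 := ((mem_rainbowH3 hyu huz).1 h2).1
      simp [h3] at h4
  · rw [Finset.pair_comm, Finset.insert_comm] at h2
    have h3 := ((mem_rainbowH3 huy hyz).1 h2).1
    rw [Finset.pair_comm] at h1
    rcases lt_or_gt_of_ne hxu with hxu | hux
    · have h4 := ((mem_rainbowH3 hxu huy).1 h1).2.1
      simp [h3] at h4
    · rw [Finset.insert_comm] at h1
      have h4 := ((mem_rainbowH3 hux hxy).1 h1).2.2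
      simp [h3] at h4

theorem rainbowH3_free {V : Type} [DecidableEq V] {F : H3 V} {A B : Finset V}
    (h : ∀ σ : {x : V // x ∈ A} ≃ Fin A.card, ∃ u ∈ B, ∃ x y z : {x : V // x ∈ A},
      ({(x : V), (y : V), u} : Finset V) ∈ F.edges ∧
      ({(y : V), (z : V), u} : Finset V) ∈ F.edges ∧ x ≠ z ∧
      ((σ x < σ y ∧ σ y < σ z) ∨ (σ z < σ y ∧ σ y < σ x)))
    {n : ℕ} (φ : Fin n → Fin n → Fin 3) : (rainbowH3 φ).free F := by
  rintro ⟨f, hf, hfe⟩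
  let _ : LinearOrder {x : V // x ∈ A} :=
    LinearOrder.lift' (fun x => f x) (hf.comp Subtype.val_injective)
  have hσ {v w} := (monoEquivOfFin {x : V // x ∈ A} (Fintype.card_coe A)).symm.lt_iff_lt (x := v) (y := w)
  obtain ⟨u, -, x, y, z, h1, h2, -, h3⟩ :=
    h (monoEquivOfFin {x : V // x ∈ A} (Fintype.card_coe A)).symm.toEquiv
  have h1 := hfe _ h1
  have h2 := hfe _ h2
  simp only [Finset.image_insert, Finset.image_singleton] at h1 h2
  rcases h3 with ⟨h3, h4⟩ | ⟨h3, h4⟩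
  · have h3 : f x < f y := hσ.1 h3
    have h4 : f y < f z := hσ.1 h4
    exact not_mem_rainbowH3_of_lt_of_lt h3 h4 h1 h2
  · have h3 : f z < f y := hσ.1 h3
    have h4 : f y < f x := hσ.1 h4
    rw [Finset.insert_comm] at h1 h2
    exact not_mem_rainbowH3_of_lt_of_lt h3 h4 h2 h1

end LowerBound

section Counting

/-- Discrepancy of colour `c` from its expected density `1 / 3` between `i` and `j`. -/
noncomputable def colourDev {α : Type*} (φ : α → α → Fin 3) (c : Fin 3) (i j : α) : ℝ :=
  (if φ i j = c then 1 else 0) - 1 / 3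

theorem sum_colourDev_triple_ge {α : Type*} [Fintype α] [DecidableEq α] {φ : α → α → Fin 3}
    {ε : ℝ} (hε : ∀ (c : Fin 3) (Y : Finset α), ∑ i, |∑ j ∈ Y, colourDev φ c i j| ≤ ε)
    (X Y Z : Finset α) :
    (X.card * Y.card * Z.card : ℝ) / 27 - 3 * Fintype.card α * ε ≤
      ((X ×ˢ Y ×ˢ Z).filter fun t => φ t.1 t.2.1 = 0 ∧ φ t.2.1 t.2.2 = 1 ∧
        φ t.1 t.2.2 = 2).card := by
  have hε0 : 0 ≤ ε := (Finset.sum_nonneg fun _ _ => abs_nonneg _).trans (hε 0 ∅)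
  set I : Fin 3 → α → α → ℝ := fun c i j => if φ i j = c then 1 else 0 with hI
  have hI0 : ∀ c i j, 0 ≤ I c i j := fun c i j => by simp only [hI]; split_ifs <;> norm_num
  have hI1 : ∀ c i j, I c i j ≤ 1 := fun c i j => by simp only [hI]; split_ifs <;> norm_num
  have key : ∀ (c : Fin 3) (T : Finset α) (w : α → ℝ) (P : α → Prop) [DecidablePred P]
      (Q : Finset α), (∀ i, 0 ≤ w i) → (∀ i, w i ≤ 1) →
      -ε ≤ ∑ i ∈ T, w i * ∑ j ∈ Q, colourDev φ c i j * (if P j then 1 else 0) := by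
    intro c T w P _ Q hw0 hw1
    have h1 : |∑ i ∈ T, w i * ∑ j ∈ Q, colourDev φ c i j * (if P j then 1 else 0)| ≤ ε := by
      refine (Finset.abs_sum_le_sum_abs _ _).trans (le_trans ?_ (hε c (Q.filter P)))
      refine le_trans (Finset.sum_le_sum fun i _ => ?_)
        (Finset.sum_le_sum_of_subset_of_nonneg (Finset.subset_univ T) fun _ _ _ => abs_nonneg _)
      simp only [mul_ite, mul_one, mul_zero]
      rw [abs_mul, abs_of_nonneg (hw0 i), ← Finset.sum_filter]
      exact mul_le_of_le_one_left (abs_nonneg _) (hw1 i)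
    exact (abs_le.1 h1).1
  have hcard : ((((X ×ˢ Y ×ˢ Z).filter fun t => φ t.1 t.2.1 = 0 ∧ φ t.2.1 t.2.2 = 1 ∧
      φ t.1 t.2.2 = 2).card : ℕ) : ℝ) =
      ∑ x ∈ X, ∑ y ∈ Y, ∑ z ∈ Z, I 0 x y * I 1 y z * I 2 x z := by
    rw [Finset.card_filter, Nat.cast_sum, Finset.sum_product]
    refine Finset.sum_congr rfl fun x _ => ?_
    rw [Finset.sum_product]
    refine Finset.sum_congr rfl fun y _ => Finset.sum_congr rfl fun z _ => ?_
    by_cases h0 : φ x y = 0 <;> by_cases h1 : φ y z = 1 <;> by_cases h2 : φ x z = 2 <;>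
      simp [hI, h0, h1, h2]
  have hn : ∀ T : Finset α, (T.card : ℝ) ≤ Fintype.card α := fun T => by
    exact_mod_cast T.card_le_univ
  have e1 : -(Fintype.card α * ε) ≤
      ∑ z ∈ Z, ∑ x ∈ X, I 2 x z * ∑ y ∈ Y, colourDev φ 0 x y * I 1 y z := by
    refine le_trans ?_ (Finset.card_nsmul_le_sum Z _ (-ε) fun z _ =>
      key 0 X (fun x => I 2 x z) (fun y => φ y z = 1) Y (fun _ => hI0 _ _ _) fun _ => hI1 _ _ _)
    rw [nsmul_eq_mul]
    nlinarith [hn Z]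
  have e2 : -(Fintype.card α * ε) ≤
      ∑ x ∈ X, ∑ y ∈ Y, 1 * ∑ z ∈ Z, colourDev φ 1 y z * I 2 x z := by
    refine le_trans ?_ (Finset.card_nsmul_le_sum X _ (-ε) fun x _ =>
      key 1 Y (fun _ => 1) (fun z => φ x z = 2) Z (fun _ => zero_le_one) fun _ => le_rfl)
    rw [nsmul_eq_mul]
    nlinarith [hn X]
  have e3 : -(Fintype.card α * ε) ≤
      ∑ y ∈ Y, ∑ x ∈ X, 1 * ∑ z ∈ Z, colourDev φ 2 x z * (if True then 1 else 0) := by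
    refine le_trans ?_ (Finset.card_nsmul_le_sum Y _ (-ε) fun y _ =>
      key 2 X (fun _ => 1) (fun _ => True) Z (fun _ => zero_le_one) fun _ => le_rfl)
    rw [nsmul_eq_mul]
    nlinarith [hn Y]
  have hsum : ∑ x ∈ X, ∑ y ∈ Y, ∑ z ∈ Z, I 0 x y * I 1 y z * I 2 x z =
      (X.card * Y.card * Z.card : ℝ) / 27 +
      ∑ z ∈ Z, ∑ x ∈ X, I 2 x z * ∑ y ∈ Y, colourDev φ 0 x y * I 1 y z +
      1 / 3 * ∑ x ∈ X, ∑ y ∈ Y, 1 * ∑ z ∈ Z, colourDev φ 1 y z * I 2 x z +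
      1 / 9 * ∑ y ∈ Y, ∑ x ∈ X, 1 * ∑ z ∈ Z, colourDev φ 2 x z * (if True then 1 else 0) := by
    have s1 : ∑ z ∈ Z, ∑ x ∈ X, I 2 x z * ∑ y ∈ Y, colourDev φ 0 x y * I 1 y z =
        ∑ x ∈ X, ∑ y ∈ Y, ∑ z ∈ Z, I 2 x z * (colourDev φ 0 x y * I 1 y z) := by
      rw [Finset.sum_comm]
      refine Finset.sum_congr rfl fun x _ => ?_
      simp only [Finset.mul_sum]
      rw [Finset.sum_comm]
    have s3 : (X.card * Y.card * Z.card : ℝ) / 27 = ∑ x ∈ X, ∑ y ∈ Y, ∑ z ∈ Z, (1 / 27 : ℝ) := by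
      simp only [Finset.sum_const, nsmul_eq_mul]
      ring
    rw [s1, s3, Finset.sum_comm (s := Y) (t := X)]
    simp only [Finset.mul_sum, ← Finset.sum_add_distrib]
    refine Finset.sum_congr rfl fun x _ => Finset.sum_congr rfl fun y _ =>
      Finset.sum_congr rfl fun z _ => ?_
    simp only [colourDev, hI, if_true]
    ring
  rw [hcard, hsum]
  have : 0 ≤ (Fintype.card α : ℝ) * ε := by positivity
  linarith

theorem rainbowH3_uniformlyDense {n : ℕ} {φ : Fin n → Fin n → Fin 3} {ε : ℝ}
    (hε : ∀ (c : Fin 3) (Y : Finset (Fin n)), ∑ i, |∑ j ∈ Y, colourDev φ c i j| ≤ ε * n ^ 2) :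
    (rainbowH3 φ).uniformlyDense (1 / 1000) (3 * ε) := by
  intro U
  set s := U.card / 3 with hs
  set e := U.orderEmbOfFin rfl with he
  have hidx : ∀ r : Fin 3, ∀ i : Fin s, r * s + i < U.card := by
    intro r i
    have h1 : (r : ℕ) * s ≤ 2 * s := Nat.mul_le_mul_right s (by omega)
    omega
  set p : Fin 3 → Fin s → Fin n := fun r i => e ⟨r * s + i, hidx r i⟩ with hp
  have hpU : ∀ r i, p r i ∈ U := fun r i => U.orderEmbOfFin_mem rfl _
  have hplt : ∀ r r' i i', r < r' → p r i < p r' i' := by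
    intro r r' i i' hr
    refine e.lt_iff_lt.2 (Fin.lt_def.2 ?_)
    have h1 : ((r : ℕ) + 1) * s ≤ r' * s := Nat.mul_le_mul_right s hr
    have h2 : (r : ℕ) * s + i < (r + 1) * s := by have := i.2; linarith
    dsimp only
    omega
  have hpinj : ∀ r, Function.Injective (p r) := by
    intro r i i' h
    have h1 := congrArg Fin.val (e.injective h)
    exact Fin.ext (by simpa using h1)
  set T : Fin 3 → Finset (Fin n) := fun r => Finset.univ.image (p r) with hT
  have hTcard : ∀ r, (T r).card = s := fun r => by
    rw [hT, Finset.card_image_of_injective _ (hpinj r), Finset.card_univ, Fintype.card_fin]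
  have hTmem : ∀ {r x}, x ∈ T r → ∃ i, p r i = x := fun h => by simpa [hT] using h
  have hTU : ∀ {r x}, x ∈ T r → x ∈ U := fun h => by
    obtain ⟨i, rfl⟩ := hTmem h
    exact hpU _ _
  have hTlt : ∀ {r r' x x'}, r < r' → x ∈ T r → x' ∈ T r' → x < x' := fun hr h h' => by
    obtain ⟨i, rfl⟩ := hTmem h
    obtain ⟨i', rfl⟩ := hTmem h'
    exact hplt _ _ _ _ hr
  have hcount := sum_colourDev_triple_ge hε (T 0) (T 1) (T 2)
  rw [hTcard, hTcard, hTcard, Fintype.card_fin] at hcount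
  have hle : ((T 0 ×ˢ T 1 ×ˢ T 2).filter fun t => φ t.1 t.2.1 = 0 ∧ φ t.2.1 t.2.2 = 1 ∧
      φ t.1 t.2.2 = 2).card ≤ ((rainbowH3 φ).edges.filter fun e => e ⊆ U).card := by
    refine Finset.card_le_card_of_injOn (fun t => {t.1, t.2.1, t.2.2}) ?_ ?_
    · rintro ⟨x, y, z⟩ h
      simp only [Finset.coe_filter, Finset.mem_product, Set.mem_ofPred_eq] at h ⊢
      obtain ⟨⟨hx, hy, hz⟩, hφ⟩ := h
      refine ⟨(mem_rainbowH3 (hTlt (by decide) hx hy) (hTlt (by decide) hy hz)).2 hφ, ?_⟩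
      intro v hv
      simp only [Finset.mem_insert, Finset.mem_singleton] at hv
      rcases hv with rfl | rfl | rfl
      exacts [hTU hx, hTU hy, hTU hz]
    · rintro ⟨x, y, z⟩ h ⟨x', y', z'⟩ h' heq
      simp only [Finset.coe_filter, Finset.mem_product, Set.mem_ofPred_eq] at h h'
      obtain ⟨⟨hx, hy, hz⟩, -⟩ := h
      obtain ⟨⟨hx', hy', hz'⟩, -⟩ := h'
      obtain ⟨rfl, rfl, rfl⟩ := eq_of_sorted_triple_eq (hTlt (by decide) hx hy)
        (hTlt (by decide) hy hz) (hTlt (by decide) hx' hy') (hTlt (by decide) hy' hz') heq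
      rfl
  have hchoose : 1 / 1000 * (U.card.choose 3 : ℝ) ≤ (s * s * s : ℝ) / 27 := by
    rcases Nat.eq_zero_or_pos s with h0 | h0
    · rw [Nat.choose_eq_zero_of_lt (by omega), h0]
      simp
    · have h1 := Nat.choose_le_pow_div (α := ℝ) 3 U.card
      have h2 : (U.card : ℝ) ≤ 5 * s := by
        have : U.card ≤ 5 * s := by omega
        exact_mod_cast this
      have h3 : (U.card : ℝ) ^ 3 ≤ (5 * s) ^ 3 := pow_le_pow_left₀ (Nat.cast_nonneg _) h2 3
      have h4 : ((Nat.factorial 3 : ℕ) : ℝ) = 6 := by norm_num [Nat.factorial]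
      rw [h4] at h1
      have h5 : (0 : ℝ) ≤ s ^ 3 := by positivity
      nlinarith
  rw [Fintype.card_fin]
  have hle' : ((((T 0 ×ˢ T 1 ×ˢ T 2).filter fun t => φ t.1 t.2.1 = 0 ∧ φ t.2.1 t.2.2 = 1 ∧
      φ t.1 t.2.2 = 2).card : ℕ) : ℝ) ≤ ((rainbowH3 φ).edges.filter fun e => e ⊆ U).card :=
    Nat.cast_le.2 hle
  linarith

end Counting

section Colouring

theorem sum_apply_mul_apply_eq_zero {m : ℕ} {f : Fin 3 → ℝ} (hf : ∑ t, f t = 0) {a b : Fin m}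
    (hab : a ≠ b) : ∑ g : Fin m → Fin 3, f (g a) * f (g b) = 0 := by
  have h1 : ∀ s : Fin 3, ∑ g : Fin m → Fin 3, f (g a) * f (g b) =
      ∑ g : Fin m → Fin 3, f (g a + s) * f (g b) := by
    intro s
    rw [← Equiv.sum_comp (Equiv.addRight (Pi.single a s))]
    simp [hab.symm]
  have h2 : ∑ _s : Fin 3, ∑ g : Fin m → Fin 3, f (g a) * f (g b) = 0 := by
    rw [Finset.sum_congr rfl fun s _ => h1 s, Finset.sum_comm]
    refine Finset.sum_eq_zero fun g _ => ?_
    have h3 : ∑ s, f (g a + s) = ∑ t, f t := Equiv.sum_comp (Equiv.addLeft (g a)) f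
    rw [← Finset.sum_mul, h3, hf, zero_mul]
  simpa using h2

/-- The colour of the pair `i, j` is the coordinate of the vector of `i` named by `j`. -/
def coordColour {m : ℕ} (i j : (Fin m → Fin 3) × Fin m) : Fin 3 := i.1 j.2

theorem sum_colourDev_mul_le {m : ℕ} (c : Fin 3) (j j' : (Fin m → Fin 3) × Fin m) :
    ∑ i, colourDev coordColour c i j * colourDev coordColour c i j' ≤
      if j.2 = j'.2 then (3 ^ m * m : ℝ) else 0 := by
  split_ifs with h
  · refine (Finset.sum_le_card_nsmul Finset.univ _ 1 fun i _ => ?_).trans_eq ?_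
    · simp only [colourDev]
      split_ifs <;> norm_num
    · simp
  · rw [Fintype.sum_prod_type_right]
    refine (Finset.sum_eq_zero fun q _ => ?_).le
    refine sum_apply_mul_apply_eq_zero (f := fun t => (if t = c then 1 else 0) - 1 / 3) ?_ h
    simp

theorem sum_abs_colourDev_coordColour_le {K : ℕ} (hK : 0 < K) (c : Fin 3)
    (Y : Finset ((Fin (K ^ 2) → Fin 3) × Fin (K ^ 2))) :
    ∑ i, |∑ j ∈ Y, colourDev coordColour c i j| ≤
      1 / K * (Fintype.card ((Fin (K ^ 2) → Fin 3) × Fin (K ^ 2)) : ℝ) ^ 2 := by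
  set P : ℝ := 3 ^ K ^ 2 with hP
  have hK' : (0 : ℝ) < K := Nat.cast_pos.2 hK
  have hcard : (Fintype.card ((Fin (K ^ 2) → Fin 3) × Fin (K ^ 2)) : ℝ) = P * K ^ 2 := by
    simp [hP]
  have h1 : ∑ i, (∑ j ∈ Y, colourDev coordColour c i j) ^ 2 ≤ P * K ^ 2 * (P * (P * K ^ 2)) := by
    calc ∑ i, (∑ j ∈ Y, colourDev coordColour c i j) ^ 2
        = ∑ j ∈ Y, ∑ j' ∈ Y, ∑ i, colourDev coordColour c i j * colourDev coordColour c i j' := by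
          simp_rw [sq, Finset.sum_mul_sum]
          rw [Finset.sum_comm]
          exact Finset.sum_congr rfl fun j _ => Finset.sum_comm
      _ ≤ ∑ j ∈ Y, ∑ j' ∈ Y, if j.2 = j'.2 then P * K ^ 2 else 0 := by
          refine Finset.sum_le_sum fun j _ => Finset.sum_le_sum fun j' _ => ?_
          simpa [hP] using sum_colourDev_mul_le c j j'
      _ ≤ ∑ j : (Fin (K ^ 2) → Fin 3) × Fin (K ^ 2), ∑ j' : (Fin (K ^ 2) → Fin 3) × Fin (K ^ 2),
            if j.2 = j'.2 then P * K ^ 2 else 0 := by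
          have h0 : ∀ j j' : (Fin (K ^ 2) → Fin 3) × Fin (K ^ 2),
              0 ≤ if j.2 = j'.2 then P * (K : ℝ) ^ 2 else 0 := fun j j' => by
            split_ifs <;> positivity
          refine (Finset.sum_le_sum fun j _ => Finset.sum_le_sum_of_subset_of_nonneg
            (Finset.subset_univ Y) fun j' _ _ => h0 j j').trans ?_
          exact Finset.sum_le_sum_of_subset_of_nonneg (Finset.subset_univ Y)
            fun j _ _ => Finset.sum_nonneg fun j' _ => h0 j j'
      _ = P * K ^ 2 * (P * (P * K ^ 2)) := by
          simp only [Fintype.sum_prod_type, Finset.sum_ite_eq, Finset.mem_univ, if_true,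
            Finset.sum_const, Finset.card_univ, Fintype.card_fin, Fintype.card_pi,
            Finset.prod_const, nsmul_eq_mul, hcard, Nat.cast_pow, Nat.cast_ofNat, ← hP]
  have h2 := sq_sum_le_card_mul_sum_sq
    (s := (Finset.univ : Finset ((Fin (K ^ 2) → Fin 3) × Fin (K ^ 2))))
    (f := fun i => |∑ j ∈ Y, colourDev coordColour c i j|)
  simp only [sq_abs, Finset.card_univ, hcard] at h2
  rw [hcard]
  refine abs_le_of_sq_le_sq' ?_ (by positivity) |>.2
  refine (h2.trans (mul_le_mul_of_nonneg_left h1 (by positivity))).trans_eq ?_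
  field_simp

theorem exists_rainbowH3_uniformlyDense {η : ℝ} (hη : 0 < η) (n₀ : ℕ) : ∃ n, n₀ ≤ n ∧
    ∃ φ : Fin n → Fin n → Fin 3, (rainbowH3 φ).uniformlyDense (1 / 1000) η := by
  obtain ⟨K, hK⟩ := exists_nat_gt (max (n₀ : ℝ) (3 / η))
  have hKn : n₀ < K := by exact_mod_cast (le_max_left _ _).trans_lt hK
  have hK0 : 0 < K := by omega
  have hK' : (0 : ℝ) < K := Nat.cast_pos.2 hK0
  have hKη : 3 * (1 / K : ℝ) ≤ η := by
    have h1 := (le_max_right _ _).trans_lt hK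
    rw [div_lt_iff₀ hη] at h1
    rw [mul_one_div, div_le_iff₀ hK']
    linarith
  set e := Fintype.equivFin ((Fin (K ^ 2) → Fin 3) × Fin (K ^ 2)) with he
  refine ⟨Fintype.card ((Fin (K ^ 2) → Fin 3) × Fin (K ^ 2)), ?_,
    fun i j => coordColour (e.symm i) (e.symm j), fun U => ?_⟩
  · rw [Fintype.card_prod, Fintype.card_fin, Fintype.card_pi]
    simp only [Fintype.card_fin, Finset.prod_const, Finset.card_univ]
    have h1 : 1 ≤ 3 ^ K ^ 2 := Nat.one_le_pow _ _ (by norm_num)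
    nlinarith
  · refine le_trans ?_ (rainbowH3_uniformlyDense (ε := 1 / K) (fun c Y => ?_) U)
    · gcongr
    · refine le_of_eq_of_le ?_ (sum_abs_colourDev_coordColour_le hK0 c (Y.map e.symm.toEmbedding))
      rw [← Equiv.sum_comp e.symm]
      simp only [Finset.sum_map]
      rfl

end Colouring

theorem uniformTuranDensity_pos {V : Type} [DecidableEq V] {F : H3 V} {A B : Finset V}
    (h : ∀ σ : {x : V // x ∈ A} ≃ Fin A.card, ∃ u ∈ B, ∃ x y z : {x : V // x ∈ A},
      ({(x : V), (y : V), u} : Finset V) ∈ F.edges ∧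
      ({(y : V), (z : V), u} : Finset V) ∈ F.edges ∧ x ≠ z ∧
      ((σ x < σ y ∧ σ y < σ z) ∨ (σ z < σ y ∧ σ y < σ x))) :
    0 < uniformTuranDensity F := by
  refine lt_of_lt_of_le (by norm_num : (0 : ℝ) < 1 / 1000) (le_csSup ⟨1, fun d hd => hd.2.1⟩
    ⟨by norm_num, by norm_num, fun η hη n₀ => ?_⟩)
  obtain ⟨n, hn, φ, hφ⟩ := exists_rainbowH3_uniformlyDense hη n₀
  exact ⟨n, hn, rainbowH3 φ, rainbowH3_free h φ, hφ⟩

/-- For a `(2,1)`-type 3-graph `F` with respect to `V(F) = A ∪ B`: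
`π_⋅(F) > 0` iff for every labeling of `A` there is `u ∈ B` whose link graph
contains a monotone `P₃` with respect to that labeling. -/
theorem stmt5 {V : Type} [DecidableEq V] [Fintype V] (F : H3 V)
    (A B : Finset V) (hdisj : Disjoint A B) (hcover : A ∪ B = Finset.univ)
    (htype : ∀ e ∈ F.edges, (e ∩ A).card = 2 ∧ (e ∩ B).card = 1) :
    0 < uniformTuranDensity F ↔
      ∀ σ : {x : V // x ∈ A} ≃ Fin A.card,
        ∃ u ∈ B, ∃ x y z : {x : V // x ∈ A},
          ({(x : V), (y : V), u} : Finset V) ∈ F.edges ∧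
          ({(y : V), (z : V), u} : Finset V) ∈ F.edges ∧ x ≠ z ∧
          ((σ x < σ y ∧ σ y < σ z) ∨ (σ z < σ y ∧ σ y < σ x)) := by
  have hcover' : ∀ v, v ∈ A ∨ v ∈ B := fun v =>
    Finset.mem_union.1 (hcover ▸ Finset.mem_univ v)
  refine ⟨fun hpos σ => ?_, uniformTuranDensity_pos⟩
  by_contra hσ
  refine (uniformTuranDensity_nonpos hcover' htype σ fun u hu x y z h1 h2 hxy hyz => ?_).not_gt hpos
  refine hσ ⟨u, hu, x, y, z, h1, h2, ?_, Or.inl ⟨hxy, hyz⟩⟩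
  rintro rfl
  exact hxy.not_gt hyz
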